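/- arXiv:1805.11635 — 6 statements merged into one kernel-verified Lean document; each statement's English description precedes it below -/
import Mathlib

section
/- Let A be a complex Banach algebra and let (S, ‖·‖_S) and (T, ‖·‖_T) be left introverted homogeneous subspaces of A*. Then S ⊆ T with ‖φ‖_T ≤ ‖φ‖_S for all φ ∈ S if and only if there exists a linear contraction Φ : T* → S*, continuous from the weak* topology of T* to the weak* topology of S*, such that Φ∘η_T = η_S. Moreover any such Φ is necessarily an algebra homomorphism with respect to the first Arens products and has weak*-dense range in S*. -/
open scoped Topology
open Filter

noncomputable section

/-- The right dual action of `A` on `A*`: `(φ · a) b = φ (a * b)`. -/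
def dAct {A : Type*} [NonUnitalNormedRing A] [NormedSpace ℂ A]
    [IsScalarTower ℂ A A] [SMulCommClass ℂ A A]
    (φ : A →L[ℂ] ℂ) (a : A) : A →L[ℂ] ℂ :=
  φ.comp (ContinuousLinearMap.mul ℂ A a)

/-- The canonical map `η : A → S*`, `⟨η a, φ⟩ = ⟨ι φ, a⟩`. -/
def etaMap {A : Type*} [NonUnitalNormedRing A] [NormedSpace ℂ A]
    [IsScalarTower ℂ A A] [SMulCommClass ℂ A A]
    {S : Type*} [NormedAddCommGroup S] [NormedSpace ℂ S]
    (ι : S →ₗ[ℂ] (A →L[ℂ] ℂ)) (hι : ∀ φ : S, ‖ι φ‖ ≤ ‖φ‖) (a : A) : S →L[ℂ] ℂ :=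
  LinearMap.mkContinuous
    { toFun := fun φ => ι φ a
      map_add' := fun φ ψ => by simp
      map_smul' := fun c φ => by simp }
    ‖a‖
    (fun φ => by
      have h1 : ‖ι φ a‖ ≤ ‖ι φ‖ * ‖a‖ := (ι φ).le_opNorm a
      have h2 : ‖ι φ‖ * ‖a‖ ≤ ‖φ‖ * ‖a‖ :=
        mul_le_mul_of_nonneg_right (hι φ) (norm_nonneg a)
      calc ‖ι φ a‖ ≤ ‖φ‖ * ‖a‖ := h1.trans h2
        _ = ‖a‖ * ‖φ‖ := mul_comm _ _)

/-- The "identity" map from the normed dual to the weak-star dual. -/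
def toW {S : Type*} [NormedAddCommGroup S] [NormedSpace ℂ S] (μ : S →L[ℂ] ℂ) :
    WeakDual ℂ S := StrongDual.toWeakDual μ

/-- The "identity" map from the weak-star dual to the normed dual. -/
def ofW {S : Type*} [NormedAddCommGroup S] [NormedSpace ℂ S] (μ : WeakDual ℂ S) :
    S →L[ℂ] ℂ := WeakDual.toStrongDual μ


theorem aux_eval {T : Type*} [NormedAddCommGroup T] [NormedSpace ℂ T]
    (f : WeakDual ℂ T →L[ℂ] ℂ) : ∃ ψ : T, ∀ μ : WeakDual ℂ T, f μ = μ ψ := by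
  obtain ⟨ψ, h⟩ := LinearMap.dualEmbedding_surjective (topDualPairing ℂ T) f
  exact ⟨ψ, fun μ => by rw [← h]; rfl⟩

theorem aux_dense_bilin {E F : Type*} [AddCommGroup E] [Module ℂ E] [Module ℝ E]
    [IsScalarTower ℝ ℂ E] [AddCommGroup F] [Module ℂ F] (B : E →ₗ[ℂ] F →ₗ[ℂ] ℂ)
    (M : Submodule ℂ (WeakBilin B))
    (h : ∀ φ : F, (∀ μ ∈ M, B μ φ = 0) → φ = 0) : Dense (M : Set (WeakBilin B)) := by
  intro x
  by_contra hx
  have hconv : Convex ℝ (closure (M : Set (WeakBilin B))) :=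
    (M.topologicalClosure.restrictScalars ℝ).convex
  obtain ⟨f, u, hu, hux⟩ := RCLike.geometric_hahn_banach_closed_point (𝕜 := ℂ) hconv
    isClosed_closure hx
  obtain ⟨φ, hf⟩ := LinearMap.dualEmbedding_surjective B f
  have hφ : ∀ μ, f μ = B μ φ := fun μ => by rw [← hf]; rfl
  have h0 : φ = 0 := by
    apply h
    intro μ hμ
    by_contra hne
    have := hu _ (subset_closure (M.smul_mem ((u : ℂ) / B μ φ) hμ))
    rw [map_smul, hφ, smul_eq_mul, div_mul_cancel₀ _ hne] at this
    simp at this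
  have h1 := hu 0 (subset_closure M.zero_mem)
  rw [hφ, h0] at hux
  simp at h1 hux
  linarith

theorem aux_dense {S : Type*} [NormedAddCommGroup S] [NormedSpace ℂ S]
    (M : Submodule ℂ (WeakDual ℂ S))
    (h : ∀ φ : S, (∀ μ ∈ M, μ φ = 0) → φ = 0) : Dense (M : Set (WeakDual ℂ S)) :=
  aux_dense_bilin (topDualPairing ℂ S) M h

theorem aux_repr {S : Type*} [NormedAddCommGroup S] [NormedSpace ℂ S]
    {T : Type*} [NormedAddCommGroup T] [NormedSpace ℂ T]
    (Φ : (T →L[ℂ] ℂ) →ₗ[ℂ] (S →L[ℂ] ℂ))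
    (hc : Continuous (fun μ : WeakDual ℂ T => toW (Φ (ofW μ)))) (φ : S) :
    ∃ ψ : T, ∀ μ : T →L[ℂ] ℂ, Φ μ φ = μ ψ := by
  let f : WeakDual ℂ T →L[ℂ] ℂ :=
    { toFun := fun μ => Φ (ofW μ) φ
      map_add' := fun μ ν => by
        have : ofW (μ + ν) = ofW μ + ofW ν := rfl
        simp [this]
      map_smul' := fun c μ => by
        have : ofW (c • μ) = c • ofW μ := rfl
        simp [this]
      cont := (WeakDual.eval_continuous φ).comp hc }
  obtain ⟨ψ, h⟩ := aux_eval f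
  exact ⟨ψ, fun μ => h (toW μ)⟩

/-- Let `(S, ‖·‖_S)` and `(T, ‖·‖_T)` be left introverted homogeneous
subspaces of `A*`.  Then `S ⊆ T` contractively iff there is a weak-star–weak-star
continuous linear contraction `Φ : T* → S*` with `Φ ∘ η_T = η_S`; and any such `Φ` has
weak-star dense range and is a homomorphism for the first Arens products (which are
characterized by `⟨μ ◻ ν, φ⟩ = ⟨μ, ν ◻ φ⟩` via the introversion operations). -/
theorem statement_2
    {A : Type*} [NonUnitalNormedRing A] [NormedSpace ℂ A] [CompleteSpace A]
    [IsScalarTower ℂ A A] [SMulCommClass ℂ A A]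
    {S : Type*} [NormedAddCommGroup S] [NormedSpace ℂ S] [CompleteSpace S]
    (ιS : S →ₗ[ℂ] (A →L[ℂ] ℂ)) (hinjS : Function.Injective ιS)
    (hιS : ∀ φ : S, ‖ιS φ‖ ≤ ‖φ‖)
    (actS : S → A → S)
    (hactS : ∀ (φ : S) (a : A), ιS (actS φ a) = dAct (ιS φ) a)
    (hactnormS : ∀ (φ : S) (a : A), ‖actS φ a‖ ≤ ‖φ‖ * ‖a‖)
    (boxS : (S →L[ℂ] ℂ) → S → S)
    (hboxS : ∀ (μ : S →L[ℂ] ℂ) (φ : S) (a : A), ιS (boxS μ φ) a = μ (actS φ a))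
    (hboxnormS : ∀ (μ : S →L[ℂ] ℂ) (φ : S), ‖boxS μ φ‖ ≤ ‖μ‖ * ‖φ‖)
    {T : Type*} [NormedAddCommGroup T] [NormedSpace ℂ T] [CompleteSpace T]
    (ιT : T →ₗ[ℂ] (A →L[ℂ] ℂ)) (hinjT : Function.Injective ιT)
    (hιT : ∀ φ : T, ‖ιT φ‖ ≤ ‖φ‖)
    (actT : T → A → T)
    (hactT : ∀ (φ : T) (a : A), ιT (actT φ a) = dAct (ιT φ) a)
    (hactnormT : ∀ (φ : T) (a : A), ‖actT φ a‖ ≤ ‖φ‖ * ‖a‖)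
    (boxT : (T →L[ℂ] ℂ) → T → T)
    (hboxT : ∀ (μ : T →L[ℂ] ℂ) (φ : T) (a : A), ιT (boxT μ φ) a = μ (actT φ a))
    (hboxnormT : ∀ (μ : T →L[ℂ] ℂ) (φ : T), ‖boxT μ φ‖ ≤ ‖μ‖ * ‖φ‖) :
    ((∀ φ : S, ∃ ψ : T, ιT ψ = ιS φ ∧ ‖ψ‖ ≤ ‖φ‖) ↔
      (∃ Φ : (T →L[ℂ] ℂ) →ₗ[ℂ] (S →L[ℂ] ℂ),
        (∀ μ, ‖Φ μ‖ ≤ ‖μ‖) ∧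
        Continuous (fun μ : WeakDual ℂ T => toW (Φ (ofW μ))) ∧
        (∀ a : A, Φ (etaMap ιT hιT a) = etaMap ιS hιS a))) ∧
    (∀ Φ : (T →L[ℂ] ℂ) →ₗ[ℂ] (S →L[ℂ] ℂ),
      (∀ μ, ‖Φ μ‖ ≤ ‖μ‖) →
      Continuous (fun μ : WeakDual ℂ T => toW (Φ (ofW μ))) →
      (∀ a : A, Φ (etaMap ιT hιT a) = etaMap ιS hιS a) →
      DenseRange (fun μ : T →L[ℂ] ℂ => toW (Φ μ)) ∧
      (∀ (arS : (S →L[ℂ] ℂ) → (S →L[ℂ] ℂ) → (S →L[ℂ] ℂ))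
         (arT : (T →L[ℂ] ℂ) → (T →L[ℂ] ℂ) → (T →L[ℂ] ℂ)),
        (∀ μ ν φ, arS μ ν φ = μ (boxS ν φ)) →
        (∀ μ ν φ, arT μ ν φ = μ (boxT ν φ)) →
        ∀ μ ν, Φ (arT μ ν) = arS (Φ μ) (Φ ν))) := by
  have etaS : ∀ a φ, etaMap ιS hιS a φ = ιS φ a := fun _ _ => rfl
  have etaT : ∀ a φ, etaMap ιT hιT a φ = ιT φ a := fun _ _ => rfl
  have key : ∀ Φ : (T →L[ℂ] ℂ) →ₗ[ℂ] (S →L[ℂ] ℂ),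
      Continuous (fun μ : WeakDual ℂ T => toW (Φ (ofW μ))) →
      (∀ a : A, Φ (etaMap ιT hιT a) = etaMap ιS hιS a) →
      ∃ j : S → T, (∀ φ (μ : T →L[ℂ] ℂ), Φ μ φ = μ (j φ)) ∧ ∀ φ, ιT (j φ) = ιS φ := by
    intro Φ hc he
    choose j hj using aux_repr Φ hc
    refine ⟨j, hj, fun φ => ?_⟩
    ext a
    rw [← etaT, ← hj, he, etaS]
  refine ⟨⟨fun h => ?_, ?_⟩, ?_⟩
  · choose j hj hn using h
    let J : S →L[ℂ] T := LinearMap.mkContinuous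
      { toFun := j
        map_add' := fun x y => hinjT (by simp [hj])
        map_smul' := fun c x => hinjT (by simp [hj]) } 1 (fun x => by simpa using hn x)
    have hJ : ∀ x, J x = j x := fun _ => rfl
    refine ⟨{ toFun := fun μ => μ.comp J
              map_add' := fun μ ν => by ext; simp
              map_smul' := fun c μ => by ext; simp }, ?_, ?_, ?_⟩
    · intro μ
      refine ContinuousLinearMap.opNorm_le_bound _ (norm_nonneg _) fun x => ?_
      exact (μ.le_opNorm _).trans (mul_le_mul_of_nonneg_left (hn x) (norm_nonneg _))
    · exact WeakDual.continuous_of_continuous_eval fun x => WeakDual.eval_continuous (J x)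
    · intro a
      ext φ
      change ιT (j φ) a = ιS φ a
      rw [hj]
  · rintro ⟨Φ, hn, hc, he⟩
    obtain ⟨j, hj, hι⟩ := key Φ hc he
    intro φ
    refine ⟨j φ, hι φ, NormedSpace.norm_le_dual_bound ℂ _ (norm_nonneg _) fun μ => ?_⟩
    rw [← hj, mul_comm]
    exact ((Φ μ).le_opNorm φ).trans (mul_le_mul_of_nonneg_right (hn μ) (norm_nonneg _))
  · intro Φ hn hc he
    obtain ⟨j, hj, hι⟩ := key Φ hc he
    constructor
    · have := aux_dense (LinearMap.range (StrongDual.toWeakDual.toLinearMap ∘ₗ Φ)) (fun φ h => by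
        have h0 : j φ = 0 := SeparatingDual.eq_zero_of_forall_dual_eq_zero (R := ℂ) fun μ => by
          rw [← hj]
          exact h _ ⟨μ, rfl⟩
        apply hinjS
        rw [← hι, h0, map_zero, map_zero])
      exact this
    · intro arS arT hS hT μ ν
      ext φ
      rw [hj, hT, hS, hj]
      congr 1
      apply hinjT
      rw [hι]
      ext a
      rw [hboxT, hboxS, hj]
      congr 1
      apply hinjT
      rw [hι, hactT, hactS, hι]

end
end

section
/- Let A be a complex Banach algebra and (𝔄, η) an HLDBA over A. Then there exists a left introverted homogeneous subspace (S, ‖·‖_S) of A* and a weak*-continuous surjective isometric algebra isomorphism Φ : (S*, ◻) → 𝔄 with Φ∘η_S = η. Moreover (S, ‖·‖_S) is unique: if (T, ‖·‖_T) is another left introverted homogeneous subspace of A* admitting a weak*-continuous surjective isometric algebra isomorphism Ψ : (T*, ◻) → 𝔄 with Ψ∘η_T = η, then T = S as subsets of A* and ‖φ‖_T = ‖φ‖_S for all φ. -/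
open scoped Topology
open Filter

noncomputable section

/-- Preadjoint of a weak-star continuous bounded linear map between duals. -/
theorem exists_preadjoint {P Q : Type*} [NormedAddCommGroup P] [NormedSpace ℂ P]
    [NormedAddCommGroup Q] [NormedSpace ℂ Q]
    (F : (P →L[ℂ] ℂ) →ₗ[ℂ] (Q →L[ℂ] ℂ)) (C : ℝ) (hC : 0 ≤ C)
    (hF : ∀ μ, ‖F μ‖ ≤ C * ‖μ‖)
    (hc : Continuous fun μ : WeakDual ℂ P => toW (F (ofW μ))) :
    ∃ f : Q →ₗ[ℂ] P, (∀ μ q, μ (f q) = F μ q) ∧ ∀ q, ‖f q‖ ≤ C * ‖q‖ := by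
  have key : ∀ q : Q, ∃ p : P, ∀ μ : P →L[ℂ] ℂ, μ p = F μ q := by
    intro q
    let g : StrongDual ℂ (WeakBilin (topDualPairing ℂ P)) :=
      { toFun := fun μ => F μ q
        map_add' := fun x y => by
          have := map_add F x y
          exact congrArg (fun h : Q →L[ℂ] ℂ => h q) this
        map_smul' := fun c x => by
          have := map_smul F c x
          exact congrArg (fun h : Q →L[ℂ] ℂ => h q) this
        cont := (WeakDual.eval_continuous q).comp hc }
    obtain ⟨p, hp⟩ := LinearMap.dualEmbedding_surjective (topDualPairing ℂ P) g
    exact ⟨p, fun μ => congrArg (fun h : StrongDual ℂ (WeakBilin (topDualPairing ℂ P)) => h μ) hp⟩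
  choose f hf using key
  have sep : ∀ x y : P, (∀ μ : P →L[ℂ] ℂ, μ x = μ y) → x = y := by
    intro x y h
    rw [← sub_eq_zero]
    refine SeparatingDual.eq_zero_of_forall_dual_eq_zero (R := ℂ) fun μ => ?_
    rw [map_sub, h μ, sub_self]
  refine ⟨{ toFun := f
            map_add' := fun x y => sep _ _ fun μ => by simp [hf]
            map_smul' := fun c x => sep _ _ fun μ => by simp [hf] }, fun μ q => hf q μ, ?_⟩
  intro q
  refine NormedSpace.norm_le_dual_bound ℂ _ (by positivity) fun μ => ?_
  change ‖μ (f q)‖ ≤ _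
  rw [hf]
  calc ‖F μ q‖ ≤ ‖F μ‖ * ‖q‖ := (F μ).le_opNorm q
    _ ≤ (C * ‖μ‖) * ‖q‖ := by gcongr; exact hF μ
    _ = _ := by ring

/-- A complete subspace annihilated only by zero is everything. -/
theorem range_eq_of_annih {P T : Type*} [NormedAddCommGroup P] [NormedSpace ℂ P] [CompleteSpace P]
    [NormedAddCommGroup T] [NormedSpace ℂ T] (f : P →ₗᵢ[ℂ] T)
    (h : ∀ μ : T →L[ℂ] ℂ, (∀ p, μ (f p) = 0) → μ = 0) (t : T) : ∃ p, f p = t := by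
  let M : Submodule ℂ T := f.toLinearMap.range
  have hM : IsClosed (M : Set T) := by
    have := f.isometry.isClosedEmbedding.isClosed_range
    have h2 : (M : Set T) = Set.range f := by ext x; rfl
    rw [h2]; exact this
  have : IsClosed (M : Set T) := hM
  have h0 : M.mkQL t = 0 := by
    refine SeparatingDual.eq_zero_of_forall_dual_eq_zero (R := ℂ) fun g => ?_
    have := h (g.comp M.mkQL) (fun p => by
      have : M.mkQL (f p) = 0 := (Submodule.Quotient.mk_eq_zero M).2 ⟨p, rfl⟩
      simp [this])
    exact congrArg (fun k : T →L[ℂ] ℂ => k t) this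
  obtain ⟨p, hp⟩ := (Submodule.Quotient.mk_eq_zero M).1 h0
  exact ⟨p, hp⟩

/-- **Representation theorem for HLDBAs.**
Let `(B, η)` be a homogeneous left dual Banach algebra over `A`, where the Banach
algebra `B` is identified with the dual of the Banach space `P` via the isometric
linear isomorphism `j`.  Then there is a left introverted homogeneous subspace
`(S, ‖·‖_S)` of `A*` (realized as the image under an injective linear map `ι` of the
Banach space `P` — so `‖·‖_S` is the norm of `P`, with module action `act` and
introversion `box`) and a weak-star continuous surjective isometric algebra isomorphism
`Φ : (S*, ◻) → B` with `Φ ∘ η_S = η`.  Moreover `(S, ‖·‖_S)` is unique: if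
`(T, ‖·‖_T)` is another left introverted homogeneous subspace of `A*` admitting such
an isomorphism `Ψ`, then `T` and `S` coincide as subspaces of `A*` with equal norms. -/
theorem statement_3
    {A : Type*} [NonUnitalNormedRing A] [NormedSpace ℂ A] [CompleteSpace A]
    [IsScalarTower ℂ A A] [SMulCommClass ℂ A A]
    {B : Type*} [NonUnitalNormedRing B] [NormedSpace ℂ B] [CompleteSpace B]
    [IsScalarTower ℂ B B] [SMulCommClass ℂ B B]
    {P : Type*} [NormedAddCommGroup P] [NormedSpace ℂ P] [CompleteSpace P]
    (j : B ≃ₗᵢ[ℂ] (P →L[ℂ] ℂ))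
    (hw : ∀ ν : B, Continuous fun μ : WeakDual ℂ P => toW (j (j.symm (ofW μ) * ν)))
    (η : A → B)
    (hadd : ∀ a b, η (a + b) = η a + η b)
    (hsmul : ∀ (c : ℂ) a, η (c • a) = c • η a)
    (hmul : ∀ a b, η (a * b) = η a * η b)
    (hnorm : ∀ a, ‖η a‖ ≤ ‖a‖)
    (hZt : ∀ a : A, Continuous fun ν : WeakDual ℂ P => toW (j (η a * j.symm (ofW ν))))
    (hdense : DenseRange fun a : A => toW (j (η a))) :
    ∃ (ι : P →ₗ[ℂ] (A →L[ℂ] ℂ)) (hι : ∀ ψ : P, ‖ι ψ‖ ≤ ‖ψ‖)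
      (act : P → A → P) (box : (P →L[ℂ] ℂ) → P → P),
      Function.Injective ι ∧
      (∀ (ψ : P) (a : A), ι (act ψ a) = dAct (ι ψ) a) ∧
      (∀ (ψ : P) (a : A), ‖act ψ a‖ ≤ ‖ψ‖ * ‖a‖) ∧
      (∀ (μ : P →L[ℂ] ℂ) (ψ : P) (a : A), ι (box μ ψ) a = μ (act ψ a)) ∧
      (∀ (μ : P →L[ℂ] ℂ) (ψ : P), ‖box μ ψ‖ ≤ ‖μ‖ * ‖ψ‖) ∧
      (∃ Φ : (P →L[ℂ] ℂ) →ₗ[ℂ] B,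
        Function.Bijective Φ ∧
        (∀ μ, ‖Φ μ‖ = ‖μ‖) ∧
        Continuous (fun μ : WeakDual ℂ P => toW (j (Φ (ofW μ)))) ∧
        (∀ (μ ν arval : P →L[ℂ] ℂ), (∀ ψ, arval ψ = μ (box ν ψ)) →
          Φ arval = Φ μ * Φ ν) ∧
        (∀ a : A, Φ (etaMap ι hι a) = η a)) ∧
      -- uniqueness
      (∀ (T : Type*) (_ : NormedAddCommGroup T), ∀ (_ : NormedSpace ℂ T)
        (_ : CompleteSpace T)
        (ιT : T →ₗ[ℂ] (A →L[ℂ] ℂ)) (hιT : ∀ φ : T, ‖ιT φ‖ ≤ ‖φ‖)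
        (actT : T → A → T) (boxT : (T →L[ℂ] ℂ) → T → T),
        Function.Injective ιT →
        (∀ (φ : T) (a : A), ιT (actT φ a) = dAct (ιT φ) a) →
        (∀ (φ : T) (a : A), ‖actT φ a‖ ≤ ‖φ‖ * ‖a‖) →
        (∀ (μ : T →L[ℂ] ℂ) (φ : T) (a : A), ιT (boxT μ φ) a = μ (actT φ a)) →
        (∀ (μ : T →L[ℂ] ℂ) (φ : T), ‖boxT μ φ‖ ≤ ‖μ‖ * ‖φ‖) →
        ∀ Ψ : (T →L[ℂ] ℂ) →ₗ[ℂ] B,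
        Function.Bijective Ψ →
        (∀ μ, ‖Ψ μ‖ = ‖μ‖) →
        Continuous (fun μ : WeakDual ℂ T => toW (j (Ψ (ofW μ)))) →
        (∀ (μ ν arval : T →L[ℂ] ℂ), (∀ φ, arval φ = μ (boxT ν φ)) →
          Ψ arval = Ψ μ * Ψ ν) →
        (∀ a : A, Ψ (etaMap ιT hιT a) = η a) →
        ((∀ φ : T, ∃ ψ : P, ι ψ = ιT φ ∧ ‖ψ‖ = ‖φ‖) ∧
         (∀ ψ : P, ∃ φ : T, ιT φ = ι ψ ∧ ‖φ‖ = ‖ψ‖))) := by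
  have hpr : ∀ a : A, ∃ f : P →ₗ[ℂ] P,
      (∀ (μ : P →L[ℂ] ℂ) q, μ (f q) = j (η a * j.symm μ) q) ∧ ∀ q, ‖f q‖ ≤ ‖a‖ * ‖q‖ := by
    intro a
    refine exists_preadjoint
      { toFun := fun μ => j (η a * j.symm μ)
        map_add' := fun x y => by simp [mul_add]
        map_smul' := fun c x => by simp [mul_smul_comm] } ‖a‖ (norm_nonneg a) ?_ (hZt a)
    intro μ
    change ‖j (η a * j.symm μ)‖ ≤ _
    rw [j.norm_map]
    refine (norm_mul_le _ _).trans ?_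
    rw [j.symm.norm_map]
    gcongr
    exact hnorm a
  have hpl : ∀ ν : P →L[ℂ] ℂ, ∃ f : P →ₗ[ℂ] P,
      (∀ (μ : P →L[ℂ] ℂ) q, μ (f q) = j (j.symm μ * j.symm ν) q) ∧ ∀ q, ‖f q‖ ≤ ‖ν‖ * ‖q‖ := by
    intro ν
    refine exists_preadjoint
      { toFun := fun μ => j (j.symm μ * j.symm ν)
        map_add' := fun x y => by simp [add_mul]
        map_smul' := fun c x => by simp [smul_mul_assoc] } ‖ν‖ (norm_nonneg ν) ?_ (hw (j.symm ν))
    intro μ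
    change ‖j (j.symm μ * j.symm ν)‖ ≤ _
    rw [j.norm_map]
    refine (norm_mul_le _ _).trans ?_
    rw [j.symm.norm_map, j.symm.norm_map, mul_comm]
  choose act hact hactn using hpr
  choose box hbox hboxn using hpl
  have hb : ∀ (ψ : P) (a : A), ‖j (η a) ψ‖ ≤ ‖ψ‖ * ‖a‖ := fun ψ a => by
    refine ((j (η a)).le_opNorm ψ).trans ?_
    rw [j.norm_map, mul_comm]
    gcongr
    exact hnorm a
  let ι : P →ₗ[ℂ] (A →L[ℂ] ℂ) :=
    { toFun := fun ψ => LinearMap.mkContinuous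
        { toFun := fun a => j (η a) ψ
          map_add' := fun a b => by simp [hadd]
          map_smul' := fun c a => by simp [hsmul] } ‖ψ‖ (hb ψ)
      map_add' := fun x y => by ext a; simp
      map_smul' := fun c x => by ext a; simp }
  have hιa : ∀ ψ a, ι ψ a = j (η a) ψ := fun ψ a => rfl
  have hι : ∀ ψ : P, ‖ι ψ‖ ≤ ‖ψ‖ := fun ψ =>
    ContinuousLinearMap.opNorm_le_bound _ (norm_nonneg _) (fun a => hb ψ a)
  have heta : ∀ a, etaMap ι hι a = j (η a) := fun a => by ext ψ; rfl
  refine ⟨ι, hι, fun ψ a => act a ψ, fun μ ψ => box μ ψ, ?_, ?_, ?_, ?_, ?_, ?_, ?_⟩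
  · rw [injective_iff_map_eq_zero]
    intro ψ hψ
    refine SeparatingDual.eq_zero_of_forall_dual_eq_zero (R := ℂ) fun μ => ?_
    have h1 : (fun μ : WeakDual ℂ P => μ ψ) = fun _ => 0 := by
      refine hdense.equalizer (WeakDual.eval_continuous ψ) continuous_const ?_
      funext a
      change ι ψ a = 0
      rw [hψ]; rfl
    exact congrFun h1 (toW μ)
  · intro ψ a
    ext b
    change j (η b) (act a ψ) = j (η (a * b)) ψ
    rw [hact, hmul, j.symm_apply_apply]
  · intro ψ a
    rw [mul_comm]; exact hactn a ψ
  · intro μ ψ a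
    change j (η a) (box μ ψ) = μ (act a ψ)
    rw [hact, hbox, j.symm_apply_apply]
  · intro μ ψ
    exact hboxn μ ψ
  · refine ⟨j.symm.toLinearEquiv.toLinearMap, j.symm.bijective, j.symm.norm_map, ?_, ?_, ?_⟩
    · have : (fun μ : WeakDual ℂ P => toW (j (j.symm.toLinearEquiv.toLinearMap (ofW μ)))) = id := by
        funext μ
        change toW (j (j.symm (ofW μ))) = μ
        rw [j.apply_symm_apply]; rfl
      rw [this]; exact continuous_id
    · intro μ ν arval h
      change j.symm arval = j.symm μ * j.symm ν
      rw [← j.apply_symm_apply arval, j.symm_apply_apply]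
      apply j.injective
      ext ψ
      rw [j.apply_symm_apply, h, hbox]
    · intro a
      change j.symm _ = _
      rw [heta, j.symm_apply_apply]
  · intro T _ _ _ ιT hιT actT boxT _ _ _ _ _ Ψ hΨb hΨn hΨc _ hΨη
    obtain ⟨f, hf, hfn⟩ := exists_preadjoint (j.toLinearEquiv.toLinearMap ∘ₗ Ψ) 1 zero_le_one
      (fun μ => by
        change ‖j (Ψ μ)‖ ≤ _
        rw [j.norm_map, hΨn, one_mul]) hΨc
    replace hf : ∀ (μ : T →L[ℂ] ℂ) q, μ (f q) = j (Ψ μ) q := hf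
    have hiso : ∀ p, ‖f p‖ = ‖p‖ := by
      intro p
      refine le_antisymm (by simpa using hfn p) ?_
      refine NormedSpace.norm_le_dual_bound ℂ _ (norm_nonneg _) fun ν => ?_
      obtain ⟨μ, hμ⟩ := hΨb.2 (j.symm ν)
      have h1 : ν = j (Ψ μ) := by rw [hμ, j.apply_symm_apply]
      have h2 : ‖ν‖ = ‖μ‖ := by rw [h1, j.norm_map, hΨn]
      rw [h2, h1, ← hf, mul_comm]
      exact μ.le_opNorm _
    have hιf : ∀ p, ιT (f p) = ι p := by
      intro p
      ext a
      change etaMap ιT hιT a (f p) = j (η a) p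
      rw [hf, hΨη]
    refine ⟨fun φ => ?_, fun ψ => ⟨f ψ, hιf ψ, hiso ψ⟩⟩
    obtain ⟨p, hp⟩ := range_eq_of_annih (⟨f, hiso⟩ : P →ₗᵢ[ℂ] T) (fun μ hμ => by
      apply hΨb.1
      apply j.injective
      ext q
      rw [← hf, map_zero, map_zero]
      exact hμ q) φ
    replace hp : f p = φ := hp
    exact ⟨p, by rw [← hιf, hp], by rw [← hp, hiso]⟩
end
end

section
/- Let A be a complex Banach algebra and X a contractive right Banach A-module. For μ ∈ F_q(A*)* and x* ∈ X*, the formula ⟨μ·x*, x⟩ = ⟨μ, x*·x⟩ (x ∈ X) defines an element μ·x* ∈ X* with ‖μ·x*‖ ≤ ‖μ‖‖x*‖, and this action makes X* a left Banach module over (F_q(A*)*, ◻): (μ◻ν)·x* = μ·(ν·x*) for all μ, ν ∈ F_q(A*)*. Moreover, for each fixed x* ∈ X* the map μ ↦ μ·x* is continuous from the weak* topology of F_q(A*)* to the weak* topology of X*, and η_q(a)·x* = a·x* for every a ∈ A. -/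
open scoped Topology
open Filter

noncomputable section

/-- coefficient functional `x* · x` of a module action: `(x* · x) a = x* (x · a)`. -/
def coeffFn {A : Type*} [NonUnitalNormedRing A] [NormedSpace ℂ A]
    [IsScalarTower ℂ A A] [SMulCommClass ℂ A A]
    {X : Type*} [NormedAddCommGroup X] [NormedSpace ℂ X]
    (m : X →L[ℂ] A →L[ℂ] X) (xs : X →L[ℂ] ℂ) (x : X) : A →L[ℂ] ℂ :=
  xs.comp (m x)

/-- Membership in the Fourier space `F_q(A*)`. -/
def FqMem {A : Type*} [NonUnitalNormedRing A] [NormedSpace ℂ A]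
    [IsScalarTower ℂ A A] [SMulCommClass ℂ A A]
    {X : Type*} [NormedAddCommGroup X] [NormedSpace ℂ X]
    (m : X →L[ℂ] A →L[ℂ] X) (φ : A →L[ℂ] ℂ) : Prop :=
  ∃ (xs : ℕ → (X →L[ℂ] ℂ)) (x : ℕ → X),
    (Summable fun n => ‖xs n‖ * ‖x n‖) ∧
    ∀ a : A, HasSum (fun n => xs n (m (x n) a)) (φ a)

/-- The Fourier norm `‖·‖_q`. -/
def qNorm {A : Type*} [NonUnitalNormedRing A] [NormedSpace ℂ A]
    [IsScalarTower ℂ A A] [SMulCommClass ℂ A A]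
    {X : Type*} [NormedAddCommGroup X] [NormedSpace ℂ X]
    (m : X →L[ℂ] A →L[ℂ] X) (φ : A →L[ℂ] ℂ) : ℝ :=
  sInf { c : ℝ | ∃ (xs : ℕ → (X →L[ℂ] ℂ)) (x : ℕ → X),
    (Summable fun n => ‖xs n‖ * ‖x n‖) ∧
    (∀ a : A, HasSum (fun n => xs n (m (x n) a)) (φ a)) ∧
    c = ∑' n, ‖xs n‖ * ‖x n‖ }

/-- The weak-star topology on `B(X*)` via its identification with `(X* ⊗ X)*`:
the coarsest topology making `T ↦ Σₙ ⟨T xₙ*, xₙ⟩` continuous for all absolutely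
summable sequences. -/
def wstarT (X : Type*) [NormedAddCommGroup X] [NormedSpace ℂ X] :
    TopologicalSpace ((X →L[ℂ] ℂ) →L[ℂ] (X →L[ℂ] ℂ)) :=
  ⨅ (p : (ℕ → (X →L[ℂ] ℂ)) × (ℕ → X)) (_ : Summable fun n => ‖p.1 n‖ * ‖p.2 n‖),
    TopologicalSpace.induced (fun T => ∑' n, T (p.1 n) (p.2 n)) inferInstance

/-- `Γ_q : A → B(X*)`, `Γ_q(a)(x*) = a · x*`, i.e. `Γ_q(a)(x*)(x) = x*(x · a)`. -/
def GammaQ {A : Type*} [NonUnitalNormedRing A] [NormedSpace ℂ A]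
    [IsScalarTower ℂ A A] [SMulCommClass ℂ A A]
    {X : Type*} [NormedAddCommGroup X] [NormedSpace ℂ X]
    (m : X →L[ℂ] A →L[ℂ] X) (a : A) : (X →L[ℂ] ℂ) →L[ℂ] (X →L[ℂ] ℂ) :=
  (ContinuousLinearMap.compL ℂ X X ℂ).flip (m.flip a)

/-- `M_q`: the weak-star closure of `Γ_q(A)` in `B(X*)`. -/
def Mq {A : Type*} [NonUnitalNormedRing A] [NormedSpace ℂ A]
    [IsScalarTower ℂ A A] [SMulCommClass ℂ A A]
    {X : Type*} [NormedAddCommGroup X] [NormedSpace ℂ X]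
    (m : X →L[ℂ] A →L[ℂ] X) : Set ((X →L[ℂ] ℂ) →L[ℂ] (X →L[ℂ] ℂ)) :=
  @closure _ (wstarT X) (Set.range fun a : A => GammaQ m a)

/-- With `S` a realization of the Fourier space `(F_q(A*), ‖·‖_q)`
(via the embedding `ιS`) and `box` the introversion operation on it, the formula
`⟨μ·x*, x⟩ = ⟨μ, x*·x⟩` defines a contractive left module action of
`(F_q(A*)*, ◻)` on `X*`, weak-star–weak-star continuous in `μ` for each fixed `x*`,
which extends the dual `A`-action: `η_q(a)·x* = a·x*`. -/
theorem statement_6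
    {A : Type*} [NonUnitalNormedRing A] [NormedSpace ℂ A] [CompleteSpace A]
    [IsScalarTower ℂ A A] [SMulCommClass ℂ A A]
    {X : Type*} [NormedAddCommGroup X] [NormedSpace ℂ X] [CompleteSpace X]
    (m : X →L[ℂ] A →L[ℂ] X)
    (hmn : ∀ (x : X) (a : A), ‖m x a‖ ≤ ‖x‖ * ‖a‖)
    (hma : ∀ (x : X) (a b : A), m (m x a) b = m x (a * b))
    {S : Type*} [NormedAddCommGroup S] [NormedSpace ℂ S] [CompleteSpace S]
    (ιS : S →ₗ[ℂ] (A →L[ℂ] ℂ)) (hinj : Function.Injective ιS)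
    (hrange : ∀ φ, FqMem m φ ↔ φ ∈ Set.range ιS)
    (hnormS : ∀ s : S, ‖s‖ = qNorm m (ιS s))
    (hcontrS : ∀ s : S, ‖ιS s‖ ≤ ‖s‖)
    (hactS : ∀ (s : S) (a : A), ∃ u : S, ιS u = dAct (ιS s) a)
    (box : (S →L[ℂ] ℂ) → S → S)
    (hbox : ∀ (ν : S →L[ℂ] ℂ) (s : S) (a : A) (u : S),
      ιS u = dAct (ιS s) a → ιS (box ν s) a = ν u) :
    ∃ act2 : (S →L[ℂ] ℂ) → (X →L[ℂ] ℂ) → (X →L[ℂ] ℂ),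
      -- defining formula `⟨μ·x*, x⟩ = ⟨μ, x*·x⟩`
      (∀ (μ : S →L[ℂ] ℂ) (xs : X →L[ℂ] ℂ) (x : X) (s : S),
        ιS s = coeffFn m xs x → act2 μ xs x = μ s) ∧
      -- contractive bilinear
      (∀ μ xs, ‖act2 μ xs‖ ≤ ‖μ‖ * ‖xs‖) ∧
      (∀ μ ν xs, act2 (μ + ν) xs = act2 μ xs + act2 ν xs) ∧
      (∀ (c : ℂ) μ xs, act2 (c • μ) xs = c • act2 μ xs) ∧
      (∀ μ xs ys, act2 μ (xs + ys) = act2 μ xs + act2 μ ys) ∧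
      (∀ (c : ℂ) μ xs, act2 μ (c • xs) = c • act2 μ xs) ∧
      -- module law for the first Arens product
      (∀ ar : (S →L[ℂ] ℂ) → (S →L[ℂ] ℂ) → (S →L[ℂ] ℂ),
        (∀ μ ν s, ar μ ν s = μ (box ν s)) →
        ∀ μ ν xs, act2 (ar μ ν) xs = act2 μ (act2 ν xs)) ∧
      -- weak-star–weak-star continuity in `μ`
      (∀ xs : X →L[ℂ] ℂ, Continuous fun μ : WeakDual ℂ S => toW (act2 (ofW μ) xs)) ∧
      -- extension of the dual `A`-module action
      (∀ (a : A) (xs : X →L[ℂ] ℂ), act2 (etaMap ιS hcontrS a) xs = xs.comp (m.flip a)) := by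
  have hex : ∀ (xs : X →L[ℂ] ℂ) (x : X), ∃ s : S, ιS s = coeffFn m xs x ∧ ‖s‖ ≤ ‖xs‖ * ‖x‖ := by
    intro xs x
    have hs : Summable fun n : ℕ =>
        ‖(if n = 0 then xs else 0 : X →L[ℂ] ℂ)‖ * ‖(if n = 0 then x else 0 : X)‖ := by
      refine summable_of_ne_finset_zero (s := {0}) ?_
      intro n hn
      simp at hn
      simp [hn]
    have hh : ∀ a : A, HasSum (fun n : ℕ => (if n = 0 then xs else 0 : X →L[ℂ] ℂ)
        (m (if n = 0 then x else 0 : X) a)) (coeffFn m xs x a) := by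
      intro a
      have := hasSum_single (f := fun n : ℕ => (if n = 0 then xs else 0 : X →L[ℂ] ℂ)
        (m (if n = 0 then x else 0 : X) a)) 0 (by intro n hn; simp [hn])
      simpa [coeffFn] using this
    obtain ⟨s, hs'⟩ := (hrange _).1 ⟨_, _, hs, hh⟩
    refine ⟨s, hs', ?_⟩
    rw [hnormS, hs']
    refine csInf_le ⟨0, ?_⟩ ⟨_, _, hs, hh, ?_⟩
    · rintro c ⟨ys, y, -, -, rfl⟩
      exact tsum_nonneg fun n => by positivity
    · rw [tsum_eq_single 0 (by intro n hn; simp [hn])]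
      simp
  choose e he hen using hex
  have heu : ∀ xs x s, ιS s = coeffFn m xs x → e xs x = s := fun xs x s h =>
    hinj ((he xs x).trans h.symm)
  have hadd : ∀ xs x y, e xs (x + y) = e xs x + e xs y := by
    intro xs x y
    apply heu
    ext a
    simp [he, coeffFn]
  have hsmul : ∀ xs (c : ℂ) x, e xs (c • x) = c • e xs x := by
    intro xs c x
    apply heu
    ext a
    simp [he, coeffFn]
  have hadd' : ∀ xs ys x, e (xs + ys) x = e xs x + e ys x := by
    intro xs x y
    apply heu
    ext a
    simp [he, coeffFn]
  have hsmul' : ∀ (c : ℂ) xs x, e (c • xs) x = c • e xs x := by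
    intro xs c x
    apply heu
    ext a
    simp [he, coeffFn]
  let E : (X →L[ℂ] ℂ) → (X →L[ℂ] S) := fun xs =>
    LinearMap.mkContinuous
      { toFun := e xs, map_add' := hadd xs, map_smul' := hsmul xs } ‖xs‖ (hen xs)
  have hE : ∀ xs x, E xs x = e xs x := fun _ _ => rfl
  have hEn : ∀ xs, ‖E xs‖ ≤ ‖xs‖ := fun xs =>
    LinearMap.mkContinuous_norm_le _ (norm_nonneg _) _
  refine ⟨fun μ xs => μ.comp (E xs), ?_, ?_, ?_, ?_, ?_, ?_, ?_, ?_, ?_⟩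
  · intro μ xs x s h
    simp [hE, heu xs x s h]
  · intro μ xs
    exact (μ.opNorm_comp_le _).trans (mul_le_mul_of_nonneg_left (hEn xs) (norm_nonneg _))
  · intro μ ν xs
    ext x
    simp
  · intro c μ xs
    ext x
    simp
  · intro μ xs ys
    ext x
    simp [hE, hadd']
  · intro c μ xs
    ext x
    simp [hE, hsmul']
  · intro ar har μ ν xs
    ext x
    simp only [ContinuousLinearMap.comp_apply, hE, har]
    congr 1
    symm
    apply heu
    ext a
    rw [hbox ν (e xs x) a (e xs (m x a))]
    · simp [coeffFn, hE]
    · ext b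
      simp [he, coeffFn, dAct, hma]
  · intro xs
    refine WeakDual.continuous_of_continuous_eval fun x => ?_
    exact WeakDual.eval_continuous (e xs x)
  · intro a xs
    ext x
    simp [hE, etaMap, he, coeffFn]

end
end

section
/- Let A be a complex Banach algebra and X a contractive right Banach A-module. The map Γ̆_q : F_q(A*)* → B(X*) defined by Γ̆_q(μ)(x*) = μ·x* (that is, ⟨Γ̆_q(μ)(x*), x⟩ = ⟨μ, x*·x⟩) is an isometric algebra isomorphism of (F_q(A*)*, ◻) onto M_q, is a homeomorphism from the weak* topology of F_q(A*)* onto the weak* topology of B(X*) restricted to M_q, and satisfies Γ̆_q∘η_q = Γ_q. Consequently its inverse T ↦ μ_T satisfies ⟨μ_T, Σ_n x_n*·x_n⟩ = Σ_n ⟨T x_n*, x_n⟩ for every element Σ_n x_n*·x_n of F_q(A*) with Σ_n ‖x_n*‖‖x_n‖ < ∞. -/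
open scoped Topology
open Filter

noncomputable section

theorem aux_wcont {X : Type*} [NormedAddCommGroup X] [NormedSpace ℂ X]
    (xs : ℕ → (X →L[ℂ] ℂ)) (x : ℕ → X) (h : Summable fun n => ‖xs n‖ * ‖x n‖) :
    @Continuous _ _ (wstarT X) _
      (fun T : (X →L[ℂ] ℂ) →L[ℂ] (X →L[ℂ] ℂ) => ∑' n, T (xs n) (x n)) := by
  rw [continuous_iff_le_induced]
  exact iInf₂_le (f := fun (p : (ℕ → (X →L[ℂ] ℂ)) × (ℕ → X))
    (_ : Summable fun n => ‖p.1 n‖ * ‖p.2 n‖) =>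
    TopologicalSpace.induced (fun T : (X →L[ℂ] ℂ) →L[ℂ] (X →L[ℂ] ℂ) =>
      ∑' n, T (p.1 n) (p.2 n)) inferInstance) (xs, x) h

theorem aux_cl_add {B : Type*} [TopologicalSpace B] {R : Set B} {f g h : B → ℂ}
    (hf : Continuous f) (hg : Continuous g) (hh : Continuous h)
    (H : ∀ T ∈ R, f T + g T = h T) : ∀ T ∈ closure R, f T + g T = h T :=
  fun _ hT => closure_minimal (s := R) (t := {T | f T + g T = h T}) H
    (isClosed_eq (hf.add hg) hh) hT

theorem aux_cl_smul {B : Type*} [TopologicalSpace B] {R : Set B} {f h : B → ℂ} (c : ℂ)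
    (hf : Continuous f) (hh : Continuous h)
    (H : ∀ T ∈ R, c * f T = h T) : ∀ T ∈ closure R, c * f T = h T :=
  fun _ hT => closure_minimal (s := R) (t := {T | c * f T = h T}) H
    (isClosed_eq (continuous_const.mul hf) hh) hT

theorem aux_cl_map {B C : Type*} [TopologicalSpace B] [TopologicalSpace C] {R : Set B} {Q : Set C}
    {f : B → C} (hf : Continuous f) (H : ∀ b ∈ R, f b ∈ Q) (hR : Dense R) (b : B) :
    f b ∈ closure Q :=
  map_mem_closure hf (hR b) H

theorem aux_subtype {B C : Type*} [TopologicalSpace B] [TopologicalSpace C] (Q : Set B)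
    {f : B → C} (hf : Continuous f) : Continuous (fun b : Q => f b.1) :=
  hf.comp continuous_subtype_val

theorem aux_dense_s7 {A : Type*} [NonUnitalNormedRing A] [NormedSpace ℂ A]
    [IsScalarTower ℂ A A] [SMulCommClass ℂ A A]
    {S : Type*} [NormedAddCommGroup S] [NormedSpace ℂ S]
    (ι : S →ₗ[ℂ] (A →L[ℂ] ℂ)) (hinj : Function.Injective ι) (hι : ∀ φ : S, ‖ι φ‖ ≤ ‖φ‖) :
    Dense (Set.range fun a : A => toW (etaMap ι hι a)) := by
  have hfin : ∀ (μ : WeakDual ℂ S) (I : Finset S), ∃ a : A, ∀ s ∈ I, ι s a = μ s := by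
    intro μ I
    classical
    let L : A →ₗ[ℂ] (I → ℂ) := LinearMap.pi fun s => (ι s.1).toLinearMap
    have hmem : (fun s : I => μ s.1) ∈ LinearMap.range L := by
      by_contra hv
      obtain ⟨f, hfv, hf⟩ := Submodule.exists_le_ker_of_notMem hv
      have hrep : ∀ v : I → ℂ, f v = ∑ i, v i * f (Pi.single i 1) := by
        intro v
        conv_lhs => rw [← Finset.univ_sum_single v]
        rw [map_sum]
        refine Finset.sum_congr rfl fun i _ => ?_
        have : Pi.single i (v i) = v i • (Pi.single i 1 : I → ℂ) := by
          rw [← Pi.single_smul]; simp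
        rw [this, map_smul, smul_eq_mul]
      have h0 : ∑ i : I, f (Pi.single i 1) • i.1 = 0 := by
        apply hinj
        rw [map_zero]
        ext a
        have h1 : f (L a) = 0 := hf ⟨a, rfl⟩
        rw [hrep] at h1
        rw [map_sum]
        simp only [map_smul, ContinuousLinearMap.sum_apply, ContinuousLinearMap.smul_apply,
          smul_eq_mul, ContinuousLinearMap.zero_apply]
        rw [← h1]
        exact Finset.sum_congr rfl fun i _ => mul_comm _ _
      apply hfv
      rw [hrep]
      have h2 : μ (∑ i : I, f (Pi.single i 1) • i.1) = 0 := by rw [h0]; exact map_zero _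
      rw [map_sum] at h2
      rw [← h2]
      refine Finset.sum_congr rfl fun i _ => ?_
      rw [map_smul, smul_eq_mul, mul_comm]
    obtain ⟨a, ha⟩ := hmem
    exact ⟨a, fun s hs => congrFun ha ⟨s, hs⟩⟩
  intro μ
  have hind : Topology.IsInducing (fun (ν : WeakDual ℂ S) (s : S) => ν s) := ⟨rfl⟩
  rw [hind.closure_eq_preimage_closure_image, Set.mem_preimage, mem_closure_iff]
  intro o ho hμ
  obtain ⟨I, u, hu, huo⟩ := isOpen_pi_iff.1 ho _ hμ
  obtain ⟨a, ha⟩ := hfin μ I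
  refine ⟨fun s => toW (etaMap ι hι a) s, huo ?_, ⟨_, ⟨a, rfl⟩, rfl⟩⟩
  intro s hs
  have : toW (etaMap ι hι a) s = μ s := ha s hs
  simp only [this]
  exact (hu s hs).2

/-- With `S` a realization of the Fourier space `(F_q(A*), ‖·‖_q)`,
the map `Γ̆_q : F_q(A*)* → B(X*)`, `⟨Γ̆_q(μ)(x*), x⟩ = ⟨μ, x*·x⟩`, is an isometric
algebra isomorphism of `(F_q(A*)*, ◻)` onto `M_q`, a homeomorphism from the weak-star
topology of `F_q(A*)*` onto the weak-star topology of `B(X*)` restricted to `M_q`,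
satisfies `Γ̆_q ∘ η_q = Γ_q`, and its inverse `T ↦ μ_T` satisfies
`⟨μ_T, Σ xₙ*·xₙ⟩ = Σ ⟨T xₙ*, xₙ⟩`. -/
theorem statement_7
    {A : Type*} [NonUnitalNormedRing A] [NormedSpace ℂ A] [CompleteSpace A]
    [IsScalarTower ℂ A A] [SMulCommClass ℂ A A]
    {X : Type*} [NormedAddCommGroup X] [NormedSpace ℂ X] [CompleteSpace X]
    (m : X →L[ℂ] A →L[ℂ] X)
    (hmn : ∀ (x : X) (a : A), ‖m x a‖ ≤ ‖x‖ * ‖a‖)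
    (hma : ∀ (x : X) (a b : A), m (m x a) b = m x (a * b))
    {S : Type*} [NormedAddCommGroup S] [NormedSpace ℂ S] [CompleteSpace S]
    (ιS : S →ₗ[ℂ] (A →L[ℂ] ℂ)) (hinj : Function.Injective ιS)
    (hrange : ∀ φ, FqMem m φ ↔ φ ∈ Set.range ιS)
    (hnormS : ∀ s : S, ‖s‖ = qNorm m (ιS s))
    (hcontrS : ∀ s : S, ‖ιS s‖ ≤ ‖s‖)
    (hactS : ∀ (s : S) (a : A), ∃ u : S, ιS u = dAct (ιS s) a)
    (box : (S →L[ℂ] ℂ) → S → S)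
    (hbox : ∀ (ν : S →L[ℂ] ℂ) (s : S) (a : A) (u : S),
      ιS u = dAct (ιS s) a → ιS (box ν s) a = ν u) :
    ∃ Γb : (S →L[ℂ] ℂ) →ₗ[ℂ] ((X →L[ℂ] ℂ) →L[ℂ] (X →L[ℂ] ℂ)),
      -- defining formula `⟨Γ̆_q(μ)(x*), x⟩ = ⟨μ, x*·x⟩`
      (∀ (μ : S →L[ℂ] ℂ) (xs : X →L[ℂ] ℂ) (x : X) (s : S),
        ιS s = coeffFn m xs x → Γb μ xs x = μ s) ∧
      -- isometric
      (∀ μ, ‖Γb μ‖ = ‖μ‖) ∧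
      -- algebra homomorphism for the first Arens product
      (∀ ar : (S →L[ℂ] ℂ) → (S →L[ℂ] ℂ) → (S →L[ℂ] ℂ),
        (∀ μ ν s, ar μ ν s = μ (box ν s)) →
        ∀ μ ν, Γb (ar μ ν) = (Γb μ).comp (Γb ν)) ∧
      -- onto `M_q`
      Set.range Γb = Mq m ∧
      -- `Γ̆_q ∘ η_q = Γ_q`
      (∀ a : A, Γb (etaMap ιS hcontrS a) = GammaQ m a) ∧
      -- weak-star–weak-star homeomorphism onto `M_q`
      (@Continuous (WeakDual ℂ S) _ _ (wstarT X) (fun μ => Γb (ofW μ))) ∧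
      (∃ hom : @Homeomorph (WeakDual ℂ S) {T // T ∈ Mq m}
          (by infer_instance) (TopologicalSpace.induced Subtype.val (wstarT X)),
        ∀ μ : WeakDual ℂ S, (hom μ : (X →L[ℂ] ℂ) →L[ℂ] (X →L[ℂ] ℂ)) = Γb (ofW μ)) ∧
      -- the inverse `T ↦ μ_T`
      (∀ T, T ∈ Mq m → ∃ μ : S →L[ℂ] ℂ, Γb μ = T ∧
        ∀ (xs : ℕ → (X →L[ℂ] ℂ)) (x : ℕ → X) (s : S),
          (Summable fun n => ‖xs n‖ * ‖x n‖) →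
          (∀ a : A, HasSum (fun n => xs n (m (x n) a)) (ιS s a)) →
          μ s = ∑' n, T (xs n) (x n)) := by
  have hιc : Continuous ιS := by
    have := (LinearMap.mkContinuous ιS 1 (fun s => by simpa using hcontrS s)).continuous
    exact this
  -- norm bound from a representation
  have hqle : ∀ (xs : ℕ → (X →L[ℂ] ℂ)) (x : ℕ → X) (s : S),
      (Summable fun n => ‖xs n‖ * ‖x n‖) →
      (∀ a : A, HasSum (fun n => xs n (m (x n) a)) (ιS s a)) →
      ‖s‖ ≤ ∑' n, ‖xs n‖ * ‖x n‖ := by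
    intro xs x s h1 h2
    rw [hnormS]
    refine csInf_le ⟨0, ?_⟩ ⟨xs, x, h1, h2, rfl⟩
    rintro c ⟨ys, y, -, -, rfl⟩
    exact tsum_nonneg fun n => by positivity
  have hrep : ∀ s : S, ∃ (xs : ℕ → (X →L[ℂ] ℂ)) (x : ℕ → X),
      (Summable fun n => ‖xs n‖ * ‖x n‖) ∧
      (∀ a : A, HasSum (fun n => xs n (m (x n) a)) (ιS s a)) :=
    fun s => (hrange _).2 ⟨s, rfl⟩
  have hleq : ∀ (s : S) (C d : ℝ), 0 ≤ C → (∀ (xs : ℕ → (X →L[ℂ] ℂ)) (x : ℕ → X),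
      (Summable fun n => ‖xs n‖ * ‖x n‖) →
      (∀ a : A, HasSum (fun n => xs n (m (x n) a)) (ιS s a)) →
      d ≤ C * ∑' n, ‖xs n‖ * ‖x n‖) → d ≤ C * ‖s‖ := by
    intro s C d hC H
    obtain ⟨xs, x, h1, h2⟩ := hrep s
    rcases hC.eq_or_lt with h0 | hpos
    · have := H xs x h1 h2
      rw [← h0] at this ⊢
      simpa using this
    · rw [← div_le_iff₀' hpos, hnormS]
      refine le_csInf ⟨_, xs, x, h1, h2, rfl⟩ ?_
      rintro c ⟨ys, y, k1, k2, rfl⟩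
      rw [div_le_iff₀' hpos]
      exact H ys y k1 k2
  have hsingle : ∀ (xs : X →L[ℂ] ℂ) (x : X) (a : A),
      HasSum (fun n : ℕ => (if n = 0 then xs else 0) (m ((fun _ : ℕ => x) n) a))
        (coeffFn m xs x a) := by
    intro xs x a
    have := hasSum_ite_eq (0 : ℕ) (coeffFn m xs x a)
    refine this.congr_fun ?_ |> fun h => h
    intro n
    by_cases hn : n = 0
    · simp [hn, coeffFn]
    · simp [hn]
  have hsn : ∀ (xs : X →L[ℂ] ℂ) (x : X), HasSum
      (fun n : ℕ => ‖(if n = 0 then xs else 0)‖ * ‖(fun _ : ℕ => x) n‖) (‖xs‖ * ‖x‖) := by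
    intro xs x
    have := hasSum_ite_eq (0 : ℕ) (‖xs‖ * ‖x‖)
    refine this.congr_fun ?_ |> fun h => h
    intro n
    by_cases hn : n = 0
    · simp [hn]
    · simp [hn]
  have hex : ∀ (xs : X →L[ℂ] ℂ) (x : X), ∃ s, ιS s = coeffFn m xs x := fun xs x =>
    (hrange _).1 ⟨_, _, (hsn xs x).summable, hsingle xs x⟩
  choose e he using hex
  have heu : ∀ xs x s, ιS s = coeffFn m xs x → s = e xs x := fun xs x s h =>
    hinj (h.trans (he xs x).symm)
  have hen : ∀ xs x, ‖e xs x‖ ≤ ‖xs‖ * ‖x‖ := by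
    intro xs x
    have := hqle _ _ (e xs x) (hsn xs x).summable (by rw [he]; exact hsingle xs x)
    rwa [(hsn xs x).tsum_eq] at this
  -- the bilinear map
  let E₀ : (X →L[ℂ] ℂ) →ₗ[ℂ] X →ₗ[ℂ] S := LinearMap.mk₂ ℂ e
    (fun xs ys x => (heu _ _ _ (by rw [map_add, he, he]; ext a; simp [coeffFn])).symm)
    (fun c xs x => (heu _ _ _ (by rw [map_smul, he]; ext a; simp [coeffFn])).symm)
    (fun xs x y => (heu _ _ _ (by rw [map_add, he, he]; ext a; simp [coeffFn])).symm)
    (fun c xs x => (heu _ _ _ (by rw [map_smul, he]; ext a; simp [coeffFn])).symm)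
  let E : (X →L[ℂ] ℂ) →L[ℂ] X →L[ℂ] S := E₀.mkContinuous₂ 1 (fun xs x => by
    simpa [E₀] using hen xs x)
  have hE : ∀ xs x, E xs x = e xs x := fun xs x => rfl
  have hsume : ∀ (xs : ℕ → (X →L[ℂ] ℂ)) (x : ℕ → X),
      (Summable fun n => ‖xs n‖ * ‖x n‖) → Summable fun n => e (xs n) (x n) :=
    fun xs x h => Summable.of_norm_bounded h fun n => hen _ _
  have heval : ∀ (xs : ℕ → (X →L[ℂ] ℂ)) (x : ℕ → X),
      (Summable fun n => ‖xs n‖ * ‖x n‖) → ∀ a,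
      HasSum (fun n => xs n (m (x n) a)) (ιS (∑' n, e (xs n) (x n)) a) := by
    intro xs x h a
    have h1 := (etaMap ιS hcontrS a).hasSum (hsume xs x h).hasSum
    refine h1.congr_fun ?_ |> fun h => h
    intro n
    change _ = ιS (e (xs n) (x n)) a
    rw [he]; rfl
  have hreps : ∀ (xs : ℕ → (X →L[ℂ] ℂ)) (x : ℕ → X) (s : S),
      (Summable fun n => ‖xs n‖ * ‖x n‖) →
      (∀ a : A, HasSum (fun n => xs n (m (x n) a)) (ιS s a)) →
      HasSum (fun n => e (xs n) (x n)) s := by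
    intro xs x s h1 h2
    have : s = ∑' n, e (xs n) (x n) := by
      apply hinj
      ext a
      exact (h2 a).unique (heval xs x h1 a)
    rw [this]
    exact (hsume xs x h1).hasSum
  let Γb : (S →L[ℂ] ℂ) →ₗ[ℂ] ((X →L[ℂ] ℂ) →L[ℂ] (X →L[ℂ] ℂ)) :=
    { toFun := fun μ => (ContinuousLinearMap.compL ℂ X S ℂ μ).comp E
      map_add' := fun μ ν => by ext; simp
      map_smul' := fun c μ => by ext; simp }
  have hΓ : ∀ μ xs x, Γb μ xs x = μ (e xs x) := fun μ xs x => rfl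
  have hμs : ∀ (μ : S →L[ℂ] ℂ) (xs : ℕ → (X →L[ℂ] ℂ)) (x : ℕ → X) (s : S),
      (Summable fun n => ‖xs n‖ * ‖x n‖) →
      (∀ a : A, HasSum (fun n => xs n (m (x n) a)) (ιS s a)) →
      HasSum (fun n => Γb μ (xs n) (x n)) (μ s) :=
    fun μ xs x s h1 h2 => μ.hasSum (hreps xs x s h1 h2)
  have hTb : ∀ (T : (X →L[ℂ] ℂ) →L[ℂ] (X →L[ℂ] ℂ)) (xs : ℕ → (X →L[ℂ] ℂ)) (x : ℕ → X),
      (Summable fun n => ‖xs n‖ * ‖x n‖) →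
      ‖∑' n, T (xs n) (x n)‖ ≤ ‖T‖ * ∑' n, ‖xs n‖ * ‖x n‖ := by
    intro T xs x h
    refine tsum_of_norm_bounded (h.hasSum.mul_left ‖T‖) fun n => ?_
    calc ‖T (xs n) (x n)‖ ≤ ‖T (xs n)‖ * ‖x n‖ := (T (xs n)).le_opNorm _
      _ ≤ (‖T‖ * ‖xs n‖) * ‖x n‖ := by gcongr; exact T.le_opNorm _
      _ = _ := mul_assoc _ _ _
  have hiso : ∀ μ, ‖Γb μ‖ = ‖μ‖ := by
    intro μ
    apply le_antisymm
    · refine ContinuousLinearMap.opNorm_le_bound _ (norm_nonneg _) fun xs => ?_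
      refine ContinuousLinearMap.opNorm_le_bound _ (by positivity) fun x => ?_
      rw [hΓ, mul_assoc]
      exact (μ.le_opNorm _).trans (by gcongr; exact hen _ _)
    · refine ContinuousLinearMap.opNorm_le_bound _ (ContinuousLinearMap.opNorm_nonneg _) fun s => ?_
      refine hleq s _ _ (ContinuousLinearMap.opNorm_nonneg _) fun xs x h1 h2 => ?_
      rw [← (hμs μ xs x s h1 h2).tsum_eq]
      exact hTb _ _ _ h1
  have heta : ∀ a : A, Γb (etaMap ιS hcontrS a) = GammaQ m a := by
    intro a
    ext xs x
    rw [hΓ]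
    change ιS (e xs x) a = _
    rw [he]; rfl
  have hcont : @Continuous (WeakDual ℂ S) _ _ (wstarT X) (fun μ => Γb (ofW μ)) := by
    unfold wstarT
    refine continuous_iInf_rng.2 fun p => continuous_iInf_rng.2 fun hp => ?_
    rw [continuous_induced_rng]
    have : ((fun T : (X →L[ℂ] ℂ) →L[ℂ] (X →L[ℂ] ℂ) => ∑' n, T (p.1 n) (p.2 n)) ∘
        fun μ : WeakDual ℂ S => Γb (ofW μ)) = fun μ => μ (∑' n, e (p.1 n) (p.2 n)) := by
      funext μ
      exact (hμs (ofW μ) p.1 p.2 _ hp (heval p.1 p.2 hp)).tsum_eq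
    rw [this]
    exact WeakDual.eval_continuous _
  have hG : ∀ (a : A) (xs : ℕ → (X →L[ℂ] ℂ)) (x : ℕ → X) (s : S),
      (Summable fun n => ‖xs n‖ * ‖x n‖) →
      (∀ a : A, HasSum (fun n => xs n (m (x n) a)) (ιS s a)) →
      ∑' n, GammaQ m a (xs n) (x n) = ιS s a := fun a xs x s _ h2 => (h2 a).tsum_eq
  -- construction of the inverse
  have hinv : ∀ T, T ∈ Mq m → ∃ μ : S →L[ℂ] ℂ, Γb μ = T ∧
        ∀ (xs : ℕ → (X →L[ℂ] ℂ)) (x : ℕ → X) (s : S),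
          (Summable fun n => ‖xs n‖ * ‖x n‖) →
          (∀ a : A, HasSum (fun n => xs n (m (x n) a)) (ιS s a)) →
          μ s = ∑' n, T (xs n) (x n) := by
    intro T hT
    choose rs r hr1 hr2 using hrep
    let F : S → ℂ := fun s => ∑' n, T (rs s n) (r s n)
    have hsmul : ∀ (c : ℂ) (s u : S) (xs : ℕ → (X →L[ℂ] ℂ)) (x : ℕ → X),
        u = c • s → (Summable fun n => ‖xs n‖ * ‖x n‖) →
        (∀ a : A, HasSum (fun n => xs n (m (x n) a)) (ιS u a)) →
        c * F s = ∑' n, T (xs n) (x n) := by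
      intro c s u xs x hu h1 h2
      refine @aux_cl_smul _ (wstarT X) _ _ _ c (aux_wcont (rs s) (r s) (hr1 s))
        (aux_wcont xs x h1) ?_ T hT
      rintro _ ⟨a, rfl⟩
      simp only
      rw [hG a _ _ _ (hr1 s) (hr2 s), hG a _ _ _ h1 h2, hu]
      simp
    have hwd : ∀ (s : S) (xs : ℕ → (X →L[ℂ] ℂ)) (x : ℕ → X),
        (Summable fun n => ‖xs n‖ * ‖x n‖) →
        (∀ a : A, HasSum (fun n => xs n (m (x n) a)) (ιS s a)) →
        F s = ∑' n, T (xs n) (x n) := by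
      intro s xs x h1 h2
      have := hsmul 1 s s xs x (by simp) h1 h2
      rwa [one_mul] at this
    have hadd : ∀ s u : S, F (s + u) = F s + F u := by
      intro s u
      symm
      refine @aux_cl_add _ (wstarT X) _ _ _ _ (aux_wcont (rs s) (r s) (hr1 s))
        (aux_wcont (rs u) (r u) (hr1 u)) (aux_wcont (rs (s + u)) (r (s + u)) (hr1 _)) ?_ T hT
      rintro _ ⟨a, rfl⟩
      simp only
      rw [hG a _ _ _ (hr1 s) (hr2 s), hG a _ _ _ (hr1 u) (hr2 u), hG a _ _ _ (hr1 _) (hr2 (s + u))]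
      simp
    let μ : S →L[ℂ] ℂ := LinearMap.mkContinuous
      { toFun := F
        map_add' := hadd
        map_smul' := fun c s => (hsmul c s (c • s) _ _ rfl (hr1 _) (hr2 _)).symm } ‖T‖ (by
      intro s
      refine hleq s _ _ (ContinuousLinearMap.opNorm_nonneg _) fun xs x h1 h2 => ?_
      change ‖F s‖ ≤ _
      rw [hwd s xs x h1 h2]
      exact hTb T xs x h1)
    refine ⟨μ, ?_, fun xs x s h1 h2 => hwd s xs x h1 h2⟩
    ext xs x
    rw [hΓ]
    change F (e xs x) = _
    rw [hwd (e xs x) _ _ (hsn xs x).summable (by rw [he]; exact hsingle xs x)]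
    rw [tsum_eq_single 0]
    · simp
    · intro n hn
      simp [hn]
  have hmem : ∀ μ : S →L[ℂ] ℂ, Γb μ ∈ Mq m := by
    intro μ
    refine @aux_cl_map (WeakDual ℂ S) _ _ (wstarT X) _ _ (fun μ => Γb (ofW μ)) hcont ?_
      (aux_dense_s7 ιS hinj hcontrS) (toW μ)
    rintro _ ⟨a, rfl⟩
    exact ⟨a, (heta a).symm⟩
  have hΓinj : Function.Injective Γb := by
    intro μ ν h
    have h1 := hiso (μ - ν)
    rw [map_sub, h, sub_self, ContinuousLinearMap.opNorm_zero] at h1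
    exact sub_eq_zero.1 (norm_eq_zero.1 h1.symm)
  refine ⟨Γb, ?_, hiso, ?_, ?_, heta, hcont, ?_, hinv⟩
  · intro μ xs x s hs
    rw [hΓ, heu xs x s hs]
  · intro ar har μ ν
    ext xs x
    rw [hΓ, har]
    change _ = Γb μ (Γb ν xs) x
    rw [hΓ]
    congr 1
    apply heu
    ext a
    rw [hbox ν (e xs x) a (e xs (m x a))]
    · rfl
    · rw [he, he]
      ext b
      simp [coeffFn, dAct, hma]
  · ext T
    constructor
    · rintro ⟨μ, rfl⟩
      exact hmem μ
    · intro hT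
      obtain ⟨μ, hμ, -⟩ := hinv T hT
      exact ⟨μ, hμ⟩
  · choose g hg1 hg2 using hinv
    refine ⟨@Homeomorph.mk (WeakDual ℂ S) {T // T ∈ Mq m} _
      (TopologicalSpace.induced Subtype.val (wstarT X))
      { toFun := fun μ => ⟨Γb (ofW μ), hmem _⟩
        invFun := fun T => toW (g T.1 T.2)
        left_inv := fun μ => hΓinj (hg1 (Γb (ofW μ)) (hmem _))
        right_inv := fun T => Subtype.ext (hg1 T.1 T.2) } ?_ ?_, fun μ => rfl⟩
    · exact continuous_induced_rng.2 hcont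
    · letI : TopologicalSpace {T // T ∈ Mq m} := TopologicalSpace.induced Subtype.val (wstarT X)
      refine WeakDual.continuous_of_continuous_eval fun s => ?_
      obtain ⟨xs, x, h1, h2⟩ := hrep s
      have : (fun T : {T // T ∈ Mq m} => (toW (g T.1 T.2)) s) =
          fun T => ∑' n, T.1 (xs n) (x n) := by
        funext T
        exact hg2 T.1 T.2 xs x s h1 h2
      change Continuous (fun T : {T // T ∈ Mq m} => (toW (g T.1 T.2)) s)
      rw [this]
      exact @aux_subtype _ _ (wstarT X) _ (Mq m) _ (aux_wcont xs x h1)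

end
end

section
/- Let A be a complex Banach algebra, X a contractive right Banach A-module, and T ∈ B(X*). Consider the statements: (a) T ∈ M_q; (b) there is a bounded linear map Λ_T : (F_q(A*), ‖·‖_q) → (F_q(A*), ‖·‖_q) such that Λ_T(x*·x) = (Tx*)·x for all x* ∈ X*, x ∈ X, and ‖Λ_T‖ ≤ ‖T‖; (c) there is a bounded linear map Λ_T : F_q(A*) → F_q(A*) with Λ_T(x*·x) = (Tx*)·x for all x*, x. Then (a) implies (b) and (b) implies (c); and if there exists a bounded net (e_i) in A with ‖x·e_i − x‖ → 0 for every x ∈ X, then (c) implies (a). Moreover, when T ∈ M_q one has Λ_T(φ) = μ_T◻φ for every φ ∈ F_q(A*), where μ_T ∈ F_q(A*)* is determined by ⟨μ_T, x*·x⟩ = ⟨Tx*, x⟩. -/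
open scoped Topology
open Filter

noncomputable section

section Helpers

set_option maxSynthPendingDepth 6

variable {A : Type*} [NonUnitalNormedRing A] [NormedSpace ℂ A]
    [IsScalarTower ℂ A A] [SMulCommClass ℂ A A]
    {X : Type*} [NormedAddCommGroup X] [NormedSpace ℂ X]

/-- Normal functionals on `B(X*)`. -/
def VV (X : Type*) [NormedAddCommGroup X] [NormedSpace ℂ X] :
    Submodule ℂ (((X →L[ℂ] ℂ) →L[ℂ] (X →L[ℂ] ℂ)) →L[ℂ] ℂ) where
  carrier := {g | ∃ (xs : ℕ → (X →L[ℂ] ℂ)) (x : ℕ → X),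
    (Summable fun n => ‖xs n‖ * ‖x n‖) ∧
    ∀ S : (X →L[ℂ] ℂ) →L[ℂ] (X →L[ℂ] ℂ), HasSum (fun n => S (xs n) (x n)) (g S)}
  zero_mem' := ⟨0, 0, by simp, fun S => by simp⟩
  add_mem' := by
    rintro g h ⟨xs, x, hs, hg⟩ ⟨ys, y, hs', hh⟩
    refine ⟨fun n => Sum.elim xs ys (Equiv.natSumNatEquivNat.symm n),
      fun n => Sum.elim x y (Equiv.natSumNatEquivNat.symm n), ?_, fun S => ?_⟩
    · refine (Equiv.summable_iff Equiv.natSumNatEquivNat.symm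
        (f := fun k : ℕ ⊕ ℕ => ‖Sum.elim xs ys k‖ * ‖Sum.elim x y k‖)).2 ?_
      exact (HasSum.sum (f := fun k : ℕ ⊕ ℕ => ‖Sum.elim xs ys k‖ * ‖Sum.elim x y k‖)
        hs.hasSum hs'.hasSum).summable
    · refine (Equiv.hasSum_iff Equiv.natSumNatEquivNat.symm
        (f := fun k : ℕ ⊕ ℕ => S (Sum.elim xs ys k) (Sum.elim x y k))).2 ?_
      exact HasSum.sum (f := fun k : ℕ ⊕ ℕ => S (Sum.elim xs ys k) (Sum.elim x y k)) (hg S) (hh S)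
  smul_mem' := by
    rintro c g ⟨xs, x, hs, hg⟩
    refine ⟨fun n => c • xs n, x, ?_, fun S => ?_⟩
    · simpa [norm_smul, mul_assoc] using hs.mul_left ‖c‖
    · simpa using (hg S).mul_left c

/-- Every absolutely summable pair of sequences gives a normal functional. -/
theorem exists_VV (xs : ℕ → (X →L[ℂ] ℂ)) (x : ℕ → X)
    (hs : Summable fun n => ‖xs n‖ * ‖x n‖) :
    ∃ g ∈ VV X, ∀ S : (X →L[ℂ] ℂ) →L[ℂ] (X →L[ℂ] ℂ),
      HasSum (fun n => S (xs n) (x n)) (g S) := by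
  have hb : ∀ (S : (X →L[ℂ] ℂ) →L[ℂ] (X →L[ℂ] ℂ)) (n : ℕ),
      ‖S (xs n) (x n)‖ ≤ ‖S‖ * (‖xs n‖ * ‖x n‖) := fun S n => by
    calc ‖S (xs n) (x n)‖ ≤ ‖S (xs n)‖ * ‖x n‖ := (S (xs n)).le_opNorm _
      _ ≤ ‖S‖ * ‖xs n‖ * ‖x n‖ := by gcongr; exact S.le_opNorm _
      _ = _ := by ring
  have hsum : ∀ S : (X →L[ℂ] ℂ) →L[ℂ] (X →L[ℂ] ℂ), Summable fun n => S (xs n) (x n) :=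
    fun S => Summable.of_norm_bounded (hs.mul_left ‖S‖) (hb S)
  let l : ((X →L[ℂ] ℂ) →L[ℂ] (X →L[ℂ] ℂ)) →ₗ[ℂ] ℂ :=
    { toFun := fun S => ∑' n, S (xs n) (x n)
      map_add' := fun S S' => (hsum S).tsum_add (hsum S')
      map_smul' := fun c S => tsum_mul_left }
  let g : ((X →L[ℂ] ℂ) →L[ℂ] (X →L[ℂ] ℂ)) →L[ℂ] ℂ :=
    l.mkContinuous (∑' n, ‖xs n‖ * ‖x n‖) fun S => by
      have := tsum_of_norm_bounded (hs.hasSum.mul_left ‖S‖) (hb S)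
      rw [mul_comm]
      exact this
  have key : ∀ S : (X →L[ℂ] ℂ) →L[ℂ] (X →L[ℂ] ℂ),
      HasSum (fun n => S (xs n) (x n)) (g S) := fun S => (hsum S).hasSum
  exact ⟨g, ⟨xs, x, hs, key⟩, key⟩

theorem GammaQ_apply (m : X →L[ℂ] A →L[ℂ] X) (a : A) (xs : X →L[ℂ] ℂ) (x : X) :
    GammaQ m a xs x = xs (m x a) := rfl

/-- `Γ_q` as a continuous linear map. -/
def GammaL (m : X →L[ℂ] A →L[ℂ] X) : A →L[ℂ] ((X →L[ℂ] ℂ) →L[ℂ] (X →L[ℂ] ℂ)) :=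
  (ContinuousLinearMap.compL ℂ X X ℂ).flip.comp m.flip

theorem GammaL_apply (m : X →L[ℂ] A →L[ℂ] X) (a : A) : GammaL m a = GammaQ m a := rfl

theorem fqMem_iff (m : X →L[ℂ] A →L[ℂ] X) (φ : A →L[ℂ] ℂ) :
    FqMem m φ ↔ ∃ g ∈ VV X, ∀ a, g (GammaQ m a) = φ a := by
  constructor
  · rintro ⟨xs, x, hs, h⟩
    obtain ⟨g, hg, hgS⟩ := exists_VV xs x hs
    exact ⟨g, hg, fun a => (hgS (GammaQ m a)).unique (h a)⟩
  · rintro ⟨g, ⟨xs, x, hs, h⟩, hg⟩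
    exact ⟨xs, x, hs, fun a => hg a ▸ h (GammaQ m a)⟩

theorem FqMem.add' {m : X →L[ℂ] A →L[ℂ] X} {φ ψ : A →L[ℂ] ℂ} (h : FqMem m φ) (h' : FqMem m ψ) :
    FqMem m (φ + ψ) := by
  rw [fqMem_iff] at *
  obtain ⟨g, hg, hga⟩ := h
  obtain ⟨g', hg', hga'⟩ := h'
  exact ⟨g + g', add_mem hg hg', fun a => by simp [hga, hga']⟩

theorem FqMem.smul' {m : X →L[ℂ] A →L[ℂ] X} {φ : A →L[ℂ] ℂ} (c : ℂ) (h : FqMem m φ) :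
    FqMem m (c • φ) := by
  rw [fqMem_iff] at *
  obtain ⟨g, hg, hga⟩ := h
  exact ⟨c • g, Submodule.smul_mem _ c hg, fun a => by simp [hga]⟩

theorem FqMem.zero' (m : X →L[ℂ] A →L[ℂ] X) : FqMem m (0 : A →L[ℂ] ℂ) :=
  (fqMem_iff m 0).2 ⟨0, zero_mem _, fun a => by simp⟩

theorem exists_VV_coeff (xs : X →L[ℂ] ℂ) (x : X) :
    ∃ g ∈ VV X, ∀ S : (X →L[ℂ] ℂ) →L[ℂ] (X →L[ℂ] ℂ), g S = S xs x := by
  obtain ⟨g, hg, h⟩ := exists_VV (fun n => if n = 0 then xs else 0) (fun n => if n = 0 then x else 0)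
    (summable_of_ne_finset_zero (s := {0}) (by intro n hn; simp at hn; simp [hn]))
  refine ⟨g, hg, fun S => (h S).unique ?_⟩
  convert hasSum_single (f := fun n => S (if n = 0 then xs else 0) (if n = 0 then x else 0)) 0
    (by intro n hn; simp [hn]) using 1
  simp

theorem VV_sub (g g₀ : ((X →L[ℂ] ℂ) →L[ℂ] (X →L[ℂ] ℂ)) →L[ℂ] ℂ) (hg : g ∈ VV X)
    (hg₀ : g₀ ∈ VV X) : ∃ h ∈ VV X, ∀ S, h S = g S - g₀ S :=
  ⟨g - g₀, sub_mem hg hg₀, fun _ => rfl⟩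

theorem FqMem.coeff (m : X →L[ℂ] A →L[ℂ] X) (xs : X →L[ℂ] ℂ) (x : X) :
    FqMem m (coeffFn m xs x) := by
  obtain ⟨g, hg, h⟩ := exists_VV_coeff xs x
  exact (fqMem_iff _ _).2 ⟨g, hg, fun a => h _⟩

theorem qNorm_nonneg (m : X →L[ℂ] A →L[ℂ] X) (φ : A →L[ℂ] ℂ) : 0 ≤ qNorm m φ := by
  apply Real.sInf_nonneg
  rintro c ⟨xs, x, -, -, rfl⟩
  exact tsum_nonneg fun n => by positivity

theorem qNorm_le (m : X →L[ℂ] A →L[ℂ] X) (φ : A →L[ℂ] ℂ) (xs : ℕ → (X →L[ℂ] ℂ)) (x : ℕ → X)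
    (hs : Summable fun n => ‖xs n‖ * ‖x n‖)
    (h : ∀ a : A, HasSum (fun n => xs n (m (x n) a)) (φ a)) :
    qNorm m φ ≤ ∑' n, ‖xs n‖ * ‖x n‖ := by
  refine csInf_le ⟨0, ?_⟩ ⟨xs, x, hs, h, rfl⟩
  rintro c ⟨xs, x, -, -, rfl⟩
  exact tsum_nonneg fun n => by positivity

theorem le_qNorm (m : X →L[ℂ] A →L[ℂ] X) (φ : A →L[ℂ] ℂ) (hφ : FqMem m φ) (r : ℝ)
    (H : ∀ (xs : ℕ → (X →L[ℂ] ℂ)) (x : ℕ → X), (Summable fun n => ‖xs n‖ * ‖x n‖) →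
      (∀ a : A, HasSum (fun n => xs n (m (x n) a)) (φ a)) → r ≤ ∑' n, ‖xs n‖ * ‖x n‖) :
    r ≤ qNorm m φ := by
  obtain ⟨xs, x, hs, h⟩ := hφ
  refine le_csInf ⟨_, xs, x, hs, h, rfl⟩ ?_
  rintro c ⟨xs, x, hs, h, rfl⟩
  exact H xs x hs h

theorem apply_le_qNorm (m : X →L[ℂ] A →L[ℂ] X) (hmn : ∀ (x : X) (a : A), ‖m x a‖ ≤ ‖x‖ * ‖a‖)
    (φ : A →L[ℂ] ℂ) (hφ : FqMem m φ) (a : A) :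
    ‖φ a‖ ≤ qNorm m φ * ‖a‖ := by
  have hb : ‖φ‖ ≤ qNorm m φ := by
    refine le_qNorm m φ hφ _ fun xs x hs h => ?_
    refine ContinuousLinearMap.opNorm_le_bound _ (tsum_nonneg fun n => by positivity) fun a => ?_
    rw [← (h a).tsum_eq]
    refine tsum_of_norm_bounded (hs.hasSum.mul_right ‖a‖) fun n => ?_
    calc ‖xs n (m (x n) a)‖ ≤ ‖xs n‖ * ‖m (x n) a‖ := (xs n).le_opNorm _
      _ ≤ ‖xs n‖ * (‖x n‖ * ‖a‖) := by gcongr; exact hmn _ _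
      _ = _ := by ring
  exact (φ.le_opNorm a).trans (by gcongr)

/-- Bounded additive functionals on the Fourier space act termwise. -/
theorem hasSum_of_bdd (m : X →L[ℂ] A →L[ℂ] X) (L : (A →L[ℂ] ℂ) → ℂ) (C : ℝ)
    (hadd : ∀ φ ψ, FqMem m φ → FqMem m ψ → L (φ + ψ) = L φ + L ψ)
    (hbd : ∀ φ, FqMem m φ → ‖L φ‖ ≤ C * qNorm m φ)
    (φ : A →L[ℂ] ℂ) (xs : ℕ → (X →L[ℂ] ℂ)) (x : ℕ → X)
    (hs : Summable fun n => ‖xs n‖ * ‖x n‖)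
    (h : ∀ a : A, HasSum (fun n => xs n (m (x n) a)) (φ a))
    (hL : Summable fun n => L (coeffFn m (xs n) (x n))) :
    HasSum (fun n => L (coeffFn m (xs n) (x n))) (L φ) := by
  rw [hL.hasSum_iff_tendsto_nat]
  -- tails
  let P : ℕ → (A →L[ℂ] ℂ) := fun N => ∑ n ∈ Finset.range N, coeffFn m (xs n) (x n)
  have hP : ∀ N, FqMem m (P N) ∧ L (P N) = ∑ n ∈ Finset.range N, L (coeffFn m (xs n) (x n)) := by
    intro N
    induction N with
    | zero =>
      refine ⟨by simpa [P] using FqMem.zero' m, ?_⟩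
      have := hadd 0 0 (FqMem.zero' m) (FqMem.zero' m)
      simpa [P] using this
    | succ N ih =>
      have e : P (N + 1) = P N + coeffFn m (xs N) (x N) := by simp [P, Finset.sum_range_succ]
      rw [e]
      refine ⟨ih.1.add' (FqMem.coeff m _ _), ?_⟩
      rw [hadd _ _ ih.1 (FqMem.coeff m _ _), ih.2, Finset.sum_range_succ]
  have htail : ∀ N, (∀ a : A, HasSum (fun n => xs (n + N) (m (x (n + N)) a)) ((φ - P N) a)) := by
    intro N a
    have := (hasSum_nat_add_iff' (f := fun n => xs n (m (x n) a)) N).2 (h a)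
    have e : (φ - P N) a = φ a - ∑ n ∈ Finset.range N, xs n (m (x n) a) := by
      show φ a - (∑ n ∈ Finset.range N, coeffFn m (xs n) (x n)) a = _
      rw [_root_.sum_apply]
      rfl
    rw [e]
    exact this
  have hsN : ∀ N, Summable fun n => ‖xs (n + N)‖ * ‖x (n + N)‖ := fun N =>
    (summable_nat_add_iff (f := fun n => ‖xs n‖ * ‖x n‖) N).2 hs
  have hb : ∀ N, ‖(∑ n ∈ Finset.range N, L (coeffFn m (xs n) (x n))) - L φ‖ ≤
      |C| * ∑' n, ‖xs (n + N)‖ * ‖x (n + N)‖ := by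
    intro N
    have hm : FqMem m (φ - P N) := ⟨_, _, hsN N, htail N⟩
    have e : L φ = L (P N) + L (φ - P N) := by rw [← hadd _ _ (hP N).1 hm]; simp
    rw [e, (hP N).2, sub_add_cancel_left, norm_neg]
    calc _ ≤ C * qNorm m (φ - P N) := hbd _ hm
      _ ≤ |C| * qNorm m (φ - P N) :=
        mul_le_mul_of_nonneg_right (le_abs_self C) (qNorm_nonneg _ _)
      _ ≤ _ := mul_le_mul_of_nonneg_left (qNorm_le m _ _ _ (hsN N) (htail N)) (abs_nonneg C)
  rw [tendsto_iff_norm_sub_tendsto_zero]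
  refine squeeze_zero (fun _ => norm_nonneg _) hb ?_
  simpa using (tendsto_sum_nat_add (fun n => ‖xs n‖ * ‖x n‖)).const_mul |C|

theorem VV_comp (S₀ : (X →L[ℂ] ℂ) →L[ℂ] (X →L[ℂ] ℂ)) (g) (hg : g ∈ VV X) :
    ∃ h ∈ VV X, ∀ S, h S = g (S.comp S₀) := by
  obtain ⟨xs, x, hs, hg⟩ := hg
  have hs' : Summable fun n => ‖S₀ (xs n)‖ * ‖x n‖ := by
    refine Summable.of_nonneg_of_le (fun n => by positivity) (fun n => ?_) (hs.mul_left ‖S₀‖)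
    rw [← mul_assoc]
    gcongr
    exact S₀.le_opNorm _
  obtain ⟨h, hh, hS⟩ := exists_VV (fun n => S₀ (xs n)) x hs'
  exact ⟨h, hh, fun S => (hS S).unique (hg (S.comp S₀))⟩

theorem VV_gamma (m : X →L[ℂ] A →L[ℂ] X) (hmn : ∀ (x : X) (a : A), ‖m x a‖ ≤ ‖x‖ * ‖a‖)
    (a : A) (g) (hg : g ∈ VV X) :
    ∃ h ∈ VV X, ∀ S, h S = g ((GammaQ m a).comp S) := by
  obtain ⟨xs, x, hs, hg⟩ := hg
  have hs' : Summable fun n => ‖xs n‖ * ‖m (x n) a‖ := by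
    refine Summable.of_nonneg_of_le (fun n => by positivity) (fun n => ?_) (hs.mul_right ‖a‖)
    rw [mul_assoc]
    gcongr
    exact hmn _ _
  obtain ⟨h, hh, hS⟩ := exists_VV xs (fun n => m (x n) a) hs'
  exact ⟨h, hh, fun S => (hS S).unique (hg ((GammaQ m a).comp S))⟩

theorem GammaQ_mul (m : X →L[ℂ] A →L[ℂ] X) (hma : ∀ (x : X) (a b : A), m (m x a) b = m x (a * b))
    (a b : A) : (GammaQ m a).comp (GammaQ m b) = GammaQ m (a * b) := by
  ext xs x
  simp [GammaQ_apply, hma]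

/-- Index type of absolutely summable pairs. -/
abbrev PP (X : Type*) [NormedAddCommGroup X] [NormedSpace ℂ X] : Type _ :=
  {p : (ℕ → (X →L[ℂ] ℂ)) × (ℕ → X) // Summable fun n => ‖p.1 n‖ * ‖p.2 n‖}

theorem wstarT_eq : wstarT X = TopologicalSpace.induced
    (fun (T : (X →L[ℂ] ℂ) →L[ℂ] (X →L[ℂ] ℂ)) (p : PP X) => ∑' n, T (p.1.1 n) (p.1.2 n))
    Pi.topologicalSpace := by
  rw [Pi.topologicalSpace, induced_iInf, wstarT, iInf_subtype]
  simp only [induced_compose]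
  rfl

/-- The bipolar description of `M_q`. -/
theorem mem_Mq_iff (m : X →L[ℂ] A →L[ℂ] X) (T : (X →L[ℂ] ℂ) →L[ℂ] (X →L[ℂ] ℂ)) :
    T ∈ Mq m ↔ ∀ g ∈ VV X, (∀ a, g (GammaQ m a) = 0) → g T = 0 := by
  have hc : T ∈ Mq m ↔ (fun p : PP X => ∑' n, T (p.1.1 n) (p.1.2 n)) ∈
      closure ((fun (T : (X →L[ℂ] ℂ) →L[ℂ] (X →L[ℂ] ℂ)) (p : PP X) =>
        ∑' n, T (p.1.1 n) (p.1.2 n)) '' (Set.range fun a : A => GammaQ m a)) := by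
    rw [Mq, wstarT_eq, closure_induced]
  rw [hc]
  constructor
  · rintro h g ⟨xs, x, hs, hg⟩ hz
    let p : PP X := ⟨(xs, x), hs⟩
    have hcl : IsClosed {v : PP X → ℂ | v p = 0} :=
      isClosed_eq (continuous_apply p) continuous_const
    have := closure_minimal (t := {v : PP X → ℂ | v p = 0}) ?_ hcl h
    · rw [← (hg T).tsum_eq]; exact this
    · rintro _ ⟨_, ⟨a, rfl⟩, rfl⟩
      exact (hg (GammaQ m a)).tsum_eq.trans (hz a)
  · intro H
    rw [mem_closure_iff_nhds]
    intro U hU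
    rw [nhds_pi, Filter.mem_pi] at hU
    obtain ⟨I, hI, t, ht, hsub⟩ := hU
    have : Fintype I := hI.fintype
    classical
    choose G hG hGS using fun p : PP X => exists_VV p.1.1 p.1.2 p.2
    let Φ : A →ₗ[ℂ] (I → ℂ) := LinearMap.pi fun i => ((G i).comp (GammaL m)).toLinearMap
    have hT : (fun i : I => G i T) ∈ LinearMap.range Φ := by
      by_contra hn
      obtain ⟨f, hf, hk⟩ := Submodule.exists_le_ker_of_notMem hn
      apply hf
      have hf' : ∀ w : I → ℂ, f w = ∑ i, f (Pi.single i 1) * w i := by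
        intro w
        rw [LinearMap.pi_apply_eq_sum_univ f w]
        refine Finset.sum_congr rfl fun i _ => ?_
        rw [smul_eq_mul, mul_comm]
        congr 2
        ext j
        simp [Pi.single_apply, eq_comm]
      have hgV : (∑ i : I, f (Pi.single i 1) • G i) ∈ VV X :=
        Submodule.sum_mem _ fun i _ => Submodule.smul_mem _ _ (hG i)
      have := H _ hgV fun a => by
        have h0 : f (Φ a) = 0 := hk ⟨a, rfl⟩
        rw [hf'] at h0
        rw [_root_.sum_apply]
        exact h0
      rw [hf']
      simpa [_root_.sum_apply] using this
    obtain ⟨a, ha⟩ := hT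
    refine ⟨_, hsub ?_, ⟨_, ⟨a, rfl⟩, rfl⟩⟩
    intro i hi
    have h1 : G i (GammaQ m a) = G i T := congrFun ha ⟨i, hi⟩
    have h2 : ∑' n, (GammaQ m a) (i.1.1 n) (i.1.2 n) = ∑' n, T (i.1.1 n) (i.1.2 n) := by
      rw [(hGS i _).tsum_eq, (hGS i _).tsum_eq, h1]
    show ∑' n, (GammaQ m a) (i.1.1 n) (i.1.2 n) ∈ t i
    rw [h2]
    exact mem_of_mem_nhds (ht i)

/-- Termwise evaluation of a bounded `Λ`. -/
theorem Lam_hasSum (m : X →L[ℂ] A →L[ℂ] X)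
    (hmn : ∀ (x : X) (a : A), ‖m x a‖ ≤ ‖x‖ * ‖a‖)
    (T : (X →L[ℂ] ℂ) →L[ℂ] (X →L[ℂ] ℂ))
    (Λ : (A →L[ℂ] ℂ) → (A →L[ℂ] ℂ)) (C : ℝ)
    (h1 : ∀ φ, FqMem m φ → FqMem m (Λ φ))
    (h2 : ∀ φ ψ, FqMem m φ → FqMem m ψ → Λ (φ + ψ) = Λ φ + Λ ψ)
    (h4 : ∀ (xs : X →L[ℂ] ℂ) (x : X), Λ (coeffFn m xs x) = coeffFn m (T xs) x)
    (h5 : ∀ φ, FqMem m φ → qNorm m (Λ φ) ≤ C * qNorm m φ)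
    (φ : A →L[ℂ] ℂ) (xs : ℕ → (X →L[ℂ] ℂ)) (x : ℕ → X)
    (hs : Summable fun n => ‖xs n‖ * ‖x n‖)
    (h : ∀ a : A, HasSum (fun n => xs n (m (x n) a)) (φ a)) (a : A) :
    HasSum (fun n => T (xs n) (m (x n) a)) (Λ φ a) := by
  have := hasSum_of_bdd m (fun φ => Λ φ a) (C * ‖a‖)
    (fun φ ψ hφ hψ => by rw [h2 φ ψ hφ hψ]; rfl)
    (fun φ hφ => by
      calc ‖Λ φ a‖ ≤ qNorm m (Λ φ) * ‖a‖ := apply_le_qNorm m hmn _ (h1 φ hφ) a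
        _ ≤ C * qNorm m φ * ‖a‖ := by gcongr; exact h5 φ hφ
        _ = _ := by ring) φ xs x hs h ?_
  · simp only [h4] at this
    exact this
  · simp only [h4]
    obtain ⟨g, -, hg⟩ := exists_VV xs x hs
    exact (hg ((GammaQ m a).comp T)).summable

end Helpers

/-- For `T ∈ B(X*)` consider: (a) `T ∈ M_q`; (b) there is a bounded
linear map `Λ_T` on `(F_q(A*), ‖·‖_q)` with `Λ_T(x*·x) = (Tx*)·x` and `‖Λ_T‖ ≤ ‖T‖`;
(c) such a `Λ_T` exists with some bound.  Then (a) → (b) → (c), and if `A` has a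
bounded approximate identity for `X` (formulated by a filter on `A`), (c) → (a).
Moreover, for `T ∈ M_q` any such `Λ_T` satisfies `Λ_T φ = μ_T ◻ φ`, where
`μ_T` is determined by `⟨μ_T, x*·x⟩ = ⟨T x*, x⟩`. -/
theorem statement_8
    {A : Type*} [NonUnitalNormedRing A] [NormedSpace ℂ A] [CompleteSpace A]
    [IsScalarTower ℂ A A] [SMulCommClass ℂ A A]
    {X : Type*} [NormedAddCommGroup X] [NormedSpace ℂ X] [CompleteSpace X]
    (m : X →L[ℂ] A →L[ℂ] X)
    (hmn : ∀ (x : X) (a : A), ‖m x a‖ ≤ ‖x‖ * ‖a‖)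
    (hma : ∀ (x : X) (a b : A), m (m x a) b = m x (a * b))
    (T : (X →L[ℂ] ℂ) →L[ℂ] (X →L[ℂ] ℂ)) :
    -- (a) → (b)
    (T ∈ Mq m →
      ∃ Λ : (A →L[ℂ] ℂ) → (A →L[ℂ] ℂ),
        (∀ φ, FqMem m φ → FqMem m (Λ φ)) ∧
        (∀ φ ψ, FqMem m φ → FqMem m ψ → Λ (φ + ψ) = Λ φ + Λ ψ) ∧
        (∀ (c : ℂ) φ, FqMem m φ → Λ (c • φ) = c • Λ φ) ∧
        (∀ (xs : X →L[ℂ] ℂ) (x : X), Λ (coeffFn m xs x) = coeffFn m (T xs) x) ∧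
        (∀ φ, FqMem m φ → qNorm m (Λ φ) ≤ ‖T‖ * qNorm m φ)) ∧
    -- (b) → (c)
    ((∃ Λ : (A →L[ℂ] ℂ) → (A →L[ℂ] ℂ),
        (∀ φ, FqMem m φ → FqMem m (Λ φ)) ∧
        (∀ φ ψ, FqMem m φ → FqMem m ψ → Λ (φ + ψ) = Λ φ + Λ ψ) ∧
        (∀ (c : ℂ) φ, FqMem m φ → Λ (c • φ) = c • Λ φ) ∧
        (∀ (xs : X →L[ℂ] ℂ) (x : X), Λ (coeffFn m xs x) = coeffFn m (T xs) x) ∧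
        (∀ φ, FqMem m φ → qNorm m (Λ φ) ≤ ‖T‖ * qNorm m φ)) →
      (∃ (Λ : (A →L[ℂ] ℂ) → (A →L[ℂ] ℂ)) (C : ℝ),
        (∀ φ, FqMem m φ → FqMem m (Λ φ)) ∧
        (∀ φ ψ, FqMem m φ → FqMem m ψ → Λ (φ + ψ) = Λ φ + Λ ψ) ∧
        (∀ (c : ℂ) φ, FqMem m φ → Λ (c • φ) = c • Λ φ) ∧
        (∀ (xs : X →L[ℂ] ℂ) (x : X), Λ (coeffFn m xs x) = coeffFn m (T xs) x) ∧
        (∀ φ, FqMem m φ → qNorm m (Λ φ) ≤ C * qNorm m φ))) ∧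
    -- (c) → (a), given a bounded approximate identity for `X`
    ((∃ F : Filter A, F.NeBot ∧ (∃ C : ℝ, ∀ᶠ a in F, ‖a‖ ≤ C) ∧
        (∀ x : X, Tendsto (fun a => m x a) F (𝓝 x))) →
      (∃ (Λ : (A →L[ℂ] ℂ) → (A →L[ℂ] ℂ)) (C : ℝ),
        (∀ φ, FqMem m φ → FqMem m (Λ φ)) ∧
        (∀ φ ψ, FqMem m φ → FqMem m ψ → Λ (φ + ψ) = Λ φ + Λ ψ) ∧
        (∀ (c : ℂ) φ, FqMem m φ → Λ (c • φ) = c • Λ φ) ∧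
        (∀ (xs : X →L[ℂ] ℂ) (x : X), Λ (coeffFn m xs x) = coeffFn m (T xs) x) ∧
        (∀ φ, FqMem m φ → qNorm m (Λ φ) ≤ C * qNorm m φ)) →
      T ∈ Mq m) ∧
    -- moreover: `Λ_T φ = μ_T ◻ φ`
    (T ∈ Mq m →
      ∀ (Λ : (A →L[ℂ] ℂ) → (A →L[ℂ] ℂ)) (C : ℝ),
        (∀ φ, FqMem m φ → FqMem m (Λ φ)) →
        (∀ φ ψ, FqMem m φ → FqMem m ψ → Λ (φ + ψ) = Λ φ + Λ ψ) →
        (∀ (c : ℂ) φ, FqMem m φ → Λ (c • φ) = c • Λ φ) →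
        (∀ (xs : X →L[ℂ] ℂ) (x : X), Λ (coeffFn m xs x) = coeffFn m (T xs) x) →
        (∀ φ, FqMem m φ → qNorm m (Λ φ) ≤ C * qNorm m φ) →
      ∀ (μT : (A →L[ℂ] ℂ) → ℂ) (C' : ℝ),
        (∀ φ ψ, FqMem m φ → FqMem m ψ → μT (φ + ψ) = μT φ + μT ψ) →
        (∀ (c : ℂ) φ, FqMem m φ → μT (c • φ) = c * μT φ) →
        (∀ φ, FqMem m φ → ‖μT φ‖ ≤ C' * qNorm m φ) →
        (∀ (xs : X →L[ℂ] ℂ) (x : X), μT (coeffFn m xs x) = T xs x) →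
      ∀ φ, FqMem m φ → ∀ a : A, Λ φ a = μT (dAct φ a)) := by
  refine ⟨?_, ?_, ?_, ?_⟩
  · intro hT
    rw [mem_Mq_iff] at hT
    -- well-definedness
    have wd : ∀ g ∈ VV X, (∀ a, g (GammaQ m a) = 0) → ∀ a, g ((GammaQ m a).comp T) = 0 := by
      intro g hg hz a
      obtain ⟨h, hh, hS⟩ := VV_gamma m hmn a g hg
      rw [← hS]
      refine hT h hh fun b => ?_
      rw [hS, GammaQ_mul m hma]
      exact hz _
    let R : ((X →L[ℂ] ℂ) →L[ℂ] (X →L[ℂ] ℂ)) →L[ℂ] ((X →L[ℂ] ℂ) →L[ℂ] (X →L[ℂ] ℂ)) :=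
      (ContinuousLinearMap.compL ℂ (X →L[ℂ] ℂ) (X →L[ℂ] ℂ) (X →L[ℂ] ℂ)).flip T
    have ex : ∀ φ : A →L[ℂ] ℂ, ∃ ψ : A →L[ℂ] ℂ, FqMem m φ →
        ∀ g ∈ VV X, (∀ a, g (GammaQ m a) = φ a) → ∀ a, ψ a = g ((GammaQ m a).comp T) := by
      intro φ
      by_cases hφ : FqMem m φ
      · obtain ⟨g₀, hg₀, h₀⟩ := (fqMem_iff m φ).1 hφ
        refine ⟨(g₀.comp R).comp (GammaL m), fun _ g hg h a => ?_⟩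
        obtain ⟨k, hk, hkS⟩ := VV_sub g₀ g hg₀ hg
        have := wd k hk (fun a => by simp [hkS, h₀, h]) a
        rw [hkS, sub_eq_zero] at this
        exact this
      · exact ⟨0, fun h => absurd h hφ⟩
    choose Λ hΛ using ex
    refine ⟨Λ, ?_, ?_, ?_, ?_, ?_⟩
    · intro φ hφ
      obtain ⟨g, hg, h⟩ := (fqMem_iff m φ).1 hφ
      obtain ⟨k, hk, hkS⟩ := VV_comp T g hg
      exact (fqMem_iff m _).2 ⟨k, hk, fun a => by rw [hkS, hΛ φ hφ g hg h]⟩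
    · intro φ ψ hφ hψ
      obtain ⟨g, hg, h⟩ := (fqMem_iff m φ).1 hφ
      obtain ⟨g', hg', h'⟩ := (fqMem_iff m ψ).1 hψ
      ext a
      rw [hΛ _ (hφ.add' hψ) (g + g') (add_mem hg hg') (fun a => by simp [h, h']),
        _root_.add_apply, _root_.add_apply, hΛ φ hφ g hg h,
        hΛ ψ hψ g' hg' h']
    · intro c φ hφ
      obtain ⟨g, hg, h⟩ := (fqMem_iff m φ).1 hφ
      ext a
      rw [hΛ _ (hφ.smul' c) (c • g) (Submodule.smul_mem _ c hg) (fun a => by simp [h]),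
        _root_.smul_apply, _root_.smul_apply, hΛ φ hφ g hg h]
    · intro xs x
      obtain ⟨g, hg, h⟩ := exists_VV_coeff xs x
      ext a
      rw [hΛ _ (FqMem.coeff m xs x) g hg (fun a => h _), h]
      rfl
    · intro φ hφ
      have key : ∀ (xs : ℕ → (X →L[ℂ] ℂ)) (x : ℕ → X), (Summable fun n => ‖xs n‖ * ‖x n‖) →
          (∀ a : A, HasSum (fun n => xs n (m (x n) a)) (φ a)) →
          qNorm m (Λ φ) ≤ ‖T‖ * ∑' n, ‖xs n‖ * ‖x n‖ := by
        intro xs x hs h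
        obtain ⟨g, hg, hgS⟩ := exists_VV xs x hs
        have hga : ∀ a, g (GammaQ m a) = φ a := fun a => (hgS (GammaQ m a)).unique (h a)
        have hle : ∀ n, ‖T (xs n)‖ * ‖x n‖ ≤ ‖T‖ * (‖xs n‖ * ‖x n‖) := fun n => by
          rw [← mul_assoc]
          gcongr
          exact T.le_opNorm _
        have hs' : Summable fun n => ‖T (xs n)‖ * ‖x n‖ :=
          Summable.of_nonneg_of_le (fun n => by positivity) hle (hs.mul_left ‖T‖)
        calc qNorm m (Λ φ) ≤ ∑' n, ‖T (xs n)‖ * ‖x n‖ := by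
              refine qNorm_le m _ (fun n => T (xs n)) x hs' fun a => ?_
              rw [hΛ φ hφ g hg hga]
              exact hgS ((GammaQ m a).comp T)
          _ ≤ ∑' n, ‖T‖ * (‖xs n‖ * ‖x n‖) := hs'.tsum_le_tsum hle (hs.mul_left ‖T‖)
          _ = _ := tsum_mul_left
      rcases (norm_nonneg T).eq_or_lt with h0 | hpos
      · obtain ⟨xs, x, hs, h⟩ := hφ
        have := key xs x hs h
        rw [← h0, zero_mul] at this ⊢
        exact this
      · rw [← div_le_iff₀' hpos]
        refine le_qNorm m φ hφ _ fun xs x hs h => ?_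
        rw [div_le_iff₀' hpos]
        exact key xs x hs h
  · rintro ⟨Λ, h⟩
    exact ⟨Λ, ‖T‖, h⟩
  · rintro ⟨F, hF, ⟨K, hK⟩, hlim⟩ ⟨Λ, C, h1, h2, -, h4, h5⟩
    rw [mem_Mq_iff]
    rintro g ⟨xs, x, hs, hg⟩ hz
    have hL := Lam_hasSum m hmn T Λ C h1 h2 h4 h5 0 xs x hs (fun a => by
      have := hg (GammaQ m a)
      rw [hz] at this
      exact this)
    have hL0 : Λ 0 = 0 := by
      have := h2 0 0 (FqMem.zero' m) (FqMem.zero' m)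
      simpa using this
    have ht : Tendsto (fun a => ∑' n, T (xs n) (m (x n) a)) F (𝓝 (∑' n, T (xs n) (x n))) := by
      refine tendsto_tsum_of_dominated_convergence
        (bound := fun n => ‖T‖ * K * (‖xs n‖ * ‖x n‖)) (hs.mul_left _) ?_ ?_
      · intro n
        exact ((T (xs n)).continuous.tendsto _).comp (hlim (x n))
      · filter_upwards [hK] with a ha n
        calc ‖T (xs n) (m (x n) a)‖ ≤ ‖T (xs n)‖ * ‖m (x n) a‖ := (T (xs n)).le_opNorm _
          _ ≤ (‖T‖ * ‖xs n‖) * (‖x n‖ * K) := by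
            gcongr
            · exact T.le_opNorm _
            · exact (hmn _ _).trans (by gcongr)
          _ = _ := by ring
    have hc : (fun a => ∑' n, T (xs n) (m (x n) a)) = fun _ => (0 : ℂ) := by
      funext a
      rw [(hL a).tsum_eq, hL0]
      rfl
    rw [hc, (hg T).tsum_eq] at ht
    exact tendsto_nhds_unique ht tendsto_const_nhds
  · intro _ Λ C h1 h2 _ h4 h5 μT C' k1 _ k3 k4 φ hφ a
    obtain ⟨xs, x, hs, h⟩ := hφ
    have hL := Lam_hasSum m hmn T Λ C h1 h2 h4 h5 φ xs x hs h a
    have hs' : Summable fun n => ‖xs n‖ * ‖m (x n) a‖ := by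
      refine Summable.of_nonneg_of_le (fun n => by positivity) (fun n => ?_) (hs.mul_right ‖a‖)
      rw [mul_assoc]
      gcongr
      exact hmn _ _
    have hR := hasSum_of_bdd m μT C' k1 k3 (dAct φ a) xs (fun n => m (x n) a) hs'
      (fun b => by simpa [dAct, hma] using h (a * b))
      (by simpa only [k4] using hL.summable)
    simp only [k4] at hR
    exact hL.unique hR

end
end

section
/- Let A be a complex Banach algebra and X a contractive right Banach A-module. If (𝔄, η) is an HLDBA over A for which there exists an isometric algebra homomorphism Γ : 𝔄 → B(X*), continuous from the weak* topology of 𝔄 to the weak* topology of B(X*), with Γ∘η = Γ_q, then (𝔄, η) ≅ (F_q(A*)*, η_q): there is a weak*-continuous surjective isometric algebra isomorphism Φ : 𝔄 → (F_q(A*)*, ◻) with Φ∘η = η_q. -/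
open scoped Topology
open Filter

noncomputable section

/-- A bounded operator from a Banach space whose adjoint is bounded below is onto. -/
lemma surj_of_dual_bound {S : Type*} [NormedAddCommGroup S] [NormedSpace ℂ S] [CompleteSpace S]
    {P : Type*} [NormedAddCommGroup P] [NormedSpace ℂ P]
    (T : S →L[ℂ] P) (h : ∀ f : P →L[ℂ] ℂ, ‖f‖ ≤ ‖f.comp T‖) : Function.Surjective T := by
  have happ : ∀ p : P, ∃ s : S, ‖p - T s‖ ≤ 1 / 2 * ‖p‖ ∧ ‖s‖ ≤ ‖p‖ := by
    intro p
    rcases eq_or_ne p 0 with rfl | hp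
    · exact ⟨0, by simp, by simp⟩
    have hp0 : 0 < ‖p‖ := norm_pos_iff.2 hp
    by_cases hmem : p ∈ closure (T '' Metric.closedBall (0 : S) ‖p‖)
    · obtain ⟨q, ⟨s, hs, rfl⟩, hq⟩ := Metric.mem_closure_iff.1 hmem (1 / 2 * ‖p‖) (by positivity)
      refine ⟨s, ?_, by simpa using hs⟩
      rw [← dist_eq_norm]; exact hq.le
    · exfalso
      have hconv : Convex ℝ (closure (T '' Metric.closedBall (0 : S) ‖p‖)) := by
        apply Convex.closure
        exact (convex_closedBall (0 : S) ‖p‖).linear_image ((T : S →ₗ[ℂ] P).restrictScalars ℝ)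
      obtain ⟨f, u, hu, hup⟩ := RCLike.geometric_hahn_banach_closed_point (𝕜 := ℂ) hconv
        isClosed_closure hmem
      have hu' : ∀ s : S, ‖s‖ ≤ ‖p‖ → (f (T s)).re < u := fun s hs =>
        hu _ (subset_closure ⟨s, by simpa using hs, rfl⟩)
      have hu0 : 0 < u := by simpa using hu' 0 (by simp)
      have hb : ‖f.comp T‖ ≤ u / ‖p‖ := by
        refine ContinuousLinearMap.opNorm_le_bound _ (by positivity) fun s => ?_
        rcases eq_or_ne (f (T s)) 0 with hz | hz
        · simp only [ContinuousLinearMap.comp_apply, hz, norm_zero]; positivity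
        have hs : s ≠ 0 := by rintro rfl; simp at hz
        have hs0 : 0 < ‖s‖ := norm_pos_iff.2 hs
        have hz0 : 0 < ‖f (T s)‖ := norm_pos_iff.2 hz
        have h1 := hu' (((starRingEnd ℂ) (f (T s)) * ((‖p‖ / ‖s‖ / ‖f (T s)‖ : ℝ) : ℂ)) • s) (by
          rw [norm_smul, norm_mul, RCLike.norm_conj, Complex.norm_real, Real.norm_eq_abs,
            abs_of_pos (by positivity)]
          apply le_of_eq; field_simp)
        have h2 : f (T (((starRingEnd ℂ) (f (T s)) * ((‖p‖ / ‖s‖ / ‖f (T s)‖ : ℝ) : ℂ)) • s))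
            = ((‖f (T s)‖ * (‖p‖ / ‖s‖) : ℝ) : ℂ) := by
          rw [map_smul, map_smul, smul_eq_mul, mul_right_comm, Complex.conj_mul']
          rw [← Complex.ofReal_pow, ← Complex.ofReal_mul]
          congr 1; field_simp
        rw [h2, Complex.ofReal_re] at h1
        simp only [ContinuousLinearMap.comp_apply]
        have h3 : ‖f (T s)‖ * (‖p‖ / ‖s‖) * (‖s‖ / ‖p‖) ≤ u * (‖s‖ / ‖p‖) := by gcongr
        calc ‖f (T s)‖ = ‖f (T s)‖ * (‖p‖ / ‖s‖) * (‖s‖ / ‖p‖) := by field_simp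
          _ ≤ u * (‖s‖ / ‖p‖) := h3
          _ = u / ‖p‖ * ‖s‖ := by ring
      have h4 : (f p).re ≤ u := by
        calc (f p).re ≤ ‖f p‖ := Complex.re_le_norm _
          _ ≤ ‖f‖ * ‖p‖ := f.le_opNorm p
          _ ≤ u / ‖p‖ * ‖p‖ := by gcongr; exact (h f).trans hb
          _ = u := by field_simp
      exact absurd hup (not_lt.2 h4)
  choose g hg using happ
  intro y
  let k : P → P := fun y => y - T (g y)
  have hnle : ∀ n : ℕ, ‖k^[n] y‖ ≤ (1 / 2) ^ n * ‖y‖ := by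
    intro n
    induction n with
    | zero => simp
    | succ n IH =>
      rw [Function.iterate_succ_apply']
      refine (hg _).1.trans ?_
      rw [pow_succ', mul_assoc]
      gcongr
  let u : ℕ → S := fun n => g (k^[n] y)
  have hsum : Summable u := by
    refine Summable.of_norm_bounded (g := fun n => (1 / 2 : ℝ) ^ n * ‖y‖) ?_ ?_
    · exact Summable.mul_right _ summable_geometric_two
    · intro n; exact (hg _).2.trans (hnle n)
  have fsumeq : ∀ n : ℕ, T (∑ i ∈ Finset.range n, u i) = y - k^[n] y := by
    intro n
    induction n with
    | zero => simp
    | succ n IH =>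
      rw [Finset.sum_range_succ, map_add, IH, Function.iterate_succ_apply']
      simp only [k, u]; abel
  refine ⟨∑' n, u n, ?_⟩
  have L₁ : Tendsto (fun n => T (∑ i ∈ Finset.range n, u i)) atTop (𝓝 (T (∑' n, u n))) :=
    (T.continuous.tendsto _).comp hsum.hasSum.tendsto_sum_nat
  simp only [fsumeq] at L₁
  have L₂ : Tendsto (fun n => y - k^[n] y) atTop (𝓝 (y - 0)) := by
    refine tendsto_const_nhds.sub ?_
    refine squeeze_zero_norm hnle ?_
    have := (tendsto_pow_atTop_nhds_zero_of_lt_one (r := (1 / 2 : ℝ)) (by norm_num)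
      (by norm_num)).mul_const ‖y‖
    simpa using this
  have := tendsto_nhds_unique L₁ L₂
  simpa using this

/-- Weak-star continuous functionals on a dual are evaluations. -/
lemma weakDual_rep {P : Type*} [NormedAddCommGroup P] [NormedSpace ℂ P]
    (L : WeakDual ℂ P →ₗ[ℂ] ℂ) (hL : Continuous L) : ∃ p : P, ∀ μ : WeakDual ℂ P, L μ = μ p := by
  obtain ⟨p, hp⟩ := LinearMap.dualEmbedding_surjective (topDualPairing ℂ P)
    (⟨L, hL⟩ : WeakDual ℂ P →L[ℂ] ℂ)
  refine ⟨p, fun μ => ?_⟩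
  have := congrArg (fun F => F μ) hp
  exact this.symm

/-- If an HLDBA `(B, η')` over `A` (predual `P`, identification `j`)
admits an isometric weak-star continuous algebra representation `Γ : B → B(X*)` with
`Γ ∘ η' = Γ_q`, then `(B, η') ≅ (F_q(A*)*, η_q)`: there is a weak-star continuous
surjective isometric algebra isomorphism `Φ : B → (F_q(A*)*, ◻)` with `Φ ∘ η' = η_q`
(the Fourier space being realized on `S`, and `◻` characterized via `box`). -/
theorem statement_10
    {A : Type*} [NonUnitalNormedRing A] [NormedSpace ℂ A] [CompleteSpace A]
    [IsScalarTower ℂ A A] [SMulCommClass ℂ A A]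
    {X : Type*} [NormedAddCommGroup X] [NormedSpace ℂ X] [CompleteSpace X]
    (m : X →L[ℂ] A →L[ℂ] X)
    (hmn : ∀ (x : X) (a : A), ‖m x a‖ ≤ ‖x‖ * ‖a‖)
    (hma : ∀ (x : X) (a b : A), m (m x a) b = m x (a * b))
    {S : Type*} [NormedAddCommGroup S] [NormedSpace ℂ S] [CompleteSpace S]
    (ιS : S →ₗ[ℂ] (A →L[ℂ] ℂ)) (hinj : Function.Injective ιS)
    (hrange : ∀ φ, FqMem m φ ↔ φ ∈ Set.range ιS)
    (hnormS : ∀ s : S, ‖s‖ = qNorm m (ιS s))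
    (hcontrS : ∀ s : S, ‖ιS s‖ ≤ ‖s‖)
    (hactS : ∀ (s : S) (a : A), ∃ u : S, ιS u = dAct (ιS s) a)
    (box : (S →L[ℂ] ℂ) → S → S)
    (hbox : ∀ (ν : S →L[ℂ] ℂ) (s : S) (a : A) (u : S),
      ιS u = dAct (ιS s) a → ιS (box ν s) a = ν u)
    {B : Type*} [NonUnitalNormedRing B] [NormedSpace ℂ B] [CompleteSpace B]
    [IsScalarTower ℂ B B] [SMulCommClass ℂ B B]
    {P : Type*} [NormedAddCommGroup P] [NormedSpace ℂ P] [CompleteSpace P]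
    (j : B ≃ₗᵢ[ℂ] (P →L[ℂ] ℂ))
    (hw : ∀ ν : B, Continuous fun μ : WeakDual ℂ P => toW (j (j.symm (ofW μ) * ν)))
    (η' : A → B)
    (hadd : ∀ a b, η' (a + b) = η' a + η' b)
    (hsmul : ∀ (c : ℂ) a, η' (c • a) = c • η' a)
    (hmul : ∀ a b, η' (a * b) = η' a * η' b)
    (hnorm : ∀ a, ‖η' a‖ ≤ ‖a‖)
    (hZt : ∀ a : A, Continuous fun ν : WeakDual ℂ P => toW (j (η' a * j.symm (ofW ν))))
    (hdense : DenseRange fun a : A => toW (j (η' a)))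
    (Γ : B →ₗ[ℂ] ((X →L[ℂ] ℂ) →L[ℂ] (X →L[ℂ] ℂ)))
    (hΓiso : ∀ b, ‖Γ b‖ = ‖b‖)
    (hΓmul : ∀ b b', Γ (b * b') = (Γ b).comp (Γ b'))
    (hΓw : @Continuous (WeakDual ℂ P) _ _ (wstarT X) (fun μ => Γ (j.symm (ofW μ))))
    (hΓη : ∀ a : A, Γ (η' a) = GammaQ m a) :
    ∃ Φ : B →ₗ[ℂ] (S →L[ℂ] ℂ),
      Function.Bijective Φ ∧
      (∀ b, ‖Φ b‖ = ‖b‖) ∧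
      Continuous (fun μ : WeakDual ℂ P => toW (Φ (j.symm (ofW μ)))) ∧
      (∀ ar : (S →L[ℂ] ℂ) → (S →L[ℂ] ℂ) → (S →L[ℂ] ℂ),
        (∀ μ ν s, ar μ ν s = μ (box ν s)) →
        ∀ b b' : B, Φ (b * b') = ar (Φ b) (Φ b')) ∧
      (∀ a : A, Φ (η' a) = etaMap ιS hcontrS a) := by
  -- evaluation against `B` is weak-star determined by the range of `η'`
  have hdet : ∀ F G : WeakDual ℂ P → ℂ, Continuous F → Continuous G →
      (∀ a, F (toW (j (η' a))) = G (toW (j (η' a)))) → ∀ b, F (toW (j b)) = G (toW (j b)) := by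
    intro F G hF hG h b
    have := hdense.equalizer hF hG (funext h)
    exact congrFun this _
  have hev : ∀ p : P, Continuous fun μ : WeakDual ℂ P => μ p := fun p => WeakDual.eval_continuous p
  have huniq : ∀ p q : P, (∀ a, j (η' a) p = j (η' a) q) → p = q := by
    intro p q h
    have h1 : ∀ b, j b p = j b q := hdet _ _ (hev p) (hev q) h
    rw [← sub_eq_zero]
    refine NormedSpace.eq_zero_of_forall_dual_eq_zero ℂ (fun f => ?_)
    have := h1 (j.symm f)
    rw [j.apply_symm_apply] at this
    rw [map_sub, this, sub_self]
  have hsumm : ∀ (xs : ℕ → (X →L[ℂ] ℂ)) (x : ℕ → X), (Summable fun n => ‖xs n‖ * ‖x n‖) →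
      ∀ b : B, (∀ n, ‖Γ b (xs n) (x n)‖ ≤ ‖b‖ * (‖xs n‖ * ‖x n‖)) ∧
        Summable fun n => Γ b (xs n) (x n) := by
    intro xs x hs b
    have h1 : ∀ n, ‖Γ b (xs n) (x n)‖ ≤ ‖b‖ * (‖xs n‖ * ‖x n‖) := by
      intro n
      calc ‖Γ b (xs n) (x n)‖ ≤ ‖Γ b (xs n)‖ * ‖x n‖ := ContinuousLinearMap.le_opNorm _ _
        _ ≤ ‖Γ b‖ * ‖xs n‖ * ‖x n‖ := by gcongr; exact ContinuousLinearMap.le_opNorm _ _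
        _ = ‖b‖ * (‖xs n‖ * ‖x n‖) := by rw [hΓiso, mul_assoc]
    exact ⟨h1, Summable.of_norm_bounded (hs.mul_left ‖b‖) h1⟩
  have key : ∀ (xs : ℕ → (X →L[ℂ] ℂ)) (x : ℕ → X), (Summable fun n => ‖xs n‖ * ‖x n‖) →
      ∃ p : P, ∀ b : B, j b p = ∑' n, Γ b (xs n) (x n) := by
    intro xs x hs
    let L : WeakDual ℂ P →ₗ[ℂ] ℂ :=
      { toFun := fun μ => ∑' n, Γ (j.symm (ofW μ)) (xs n) (x n)
        map_add' := fun μ ν => by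
          have : ofW (μ + ν) = ofW μ + ofW ν := rfl
          rw [this, map_add, map_add,
            ← ((hsumm xs x hs (j.symm (ofW μ))).2).tsum_add (hsumm xs x hs (j.symm (ofW ν))).2]
          rfl
        map_smul' := fun c μ => by
          have : ofW (c • μ) = c • ofW μ := rfl
          rw [this, map_smul, map_smul, RingHom.id_apply, smul_eq_mul, ← tsum_mul_left]
          rfl }
    have hL : Continuous L := by
      have h1 : @Continuous _ _ (wstarT X) _
          (fun T : (X →L[ℂ] ℂ) →L[ℂ] (X →L[ℂ] ℂ) => ∑' n, T (xs n) (x n)) := by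
        refine continuous_iff_le_induced.2 ?_
        exact iInf₂_le (xs, x) hs
      exact @Continuous.comp _ _ _ _ (wstarT X) _ _ _ h1 hΓw
    obtain ⟨p, hp⟩ := weakDual_rep L hL
    refine ⟨p, fun b => ?_⟩
    have h2 := hp (toW (j b))
    have h3 : L (toW (j b)) = ∑' n, Γ (j.symm (j b)) (xs n) (x n) := rfl
    rw [h3, j.symm_apply_apply] at h2
    exact h2.symm
  -- the element of the predual attached to a representation
  have key2 : ∀ (s : S) (xs : ℕ → (X →L[ℂ] ℂ)) (x : ℕ → X),
      (Summable fun n => ‖xs n‖ * ‖x n‖) →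
      (∀ a : A, HasSum (fun n => xs n (m (x n) a)) (ιS s a)) →
      ∃ p : P, (∀ a, j (η' a) p = ιS s a) ∧ (∀ b : B, j b p = ∑' n, Γ b (xs n) (x n)) ∧
        ‖p‖ ≤ ∑' n, ‖xs n‖ * ‖x n‖ := by
    intro s xs x hs hx
    obtain ⟨p, hp⟩ := key xs x hs
    refine ⟨p, fun a => ?_, hp, ?_⟩
    · rw [hp, hΓη, ← (hx a).tsum_eq]
      rfl
    · refine NormedSpace.norm_le_dual_bound ℂ p (tsum_nonneg fun n => by positivity) fun f => ?_
      have h1 := hp (j.symm f)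
      rw [j.apply_symm_apply] at h1
      rw [h1]
      have h2 := hsumm xs x hs (j.symm f)
      rw [j.symm.norm_map] at h2
      calc ‖∑' n, Γ (j.symm f) (xs n) (x n)‖ ≤ ∑' n, ‖f‖ * (‖xs n‖ * ‖x n‖) :=
            tsum_of_norm_bounded (hs.mul_left ‖f‖).hasSum h2.1
        _ = (∑' n, ‖xs n‖ * ‖x n‖) * ‖f‖ := by rw [tsum_mul_left, mul_comm]
  have hex : ∀ s : S, ∃ p : P, ∀ a, j (η' a) p = ιS s a := by
    intro s
    obtain ⟨xs, x, hs, hx⟩ := (hrange (ιS s)).2 ⟨s, rfl⟩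
    obtain ⟨p, hp, -⟩ := key2 s xs x hs hx
    exact ⟨p, hp⟩
  choose T0 hT0 using hex
  have hT0n : ∀ s, ‖T0 s‖ ≤ 1 * ‖s‖ := by
    intro s
    rw [one_mul, hnormS, qNorm]
    obtain ⟨xs, x, hs, hx⟩ := (hrange (ιS s)).2 ⟨s, rfl⟩
    refine le_csInf ⟨_, xs, x, hs, hx, rfl⟩ ?_
    rintro c ⟨xs, x, hs, hx, rfl⟩
    obtain ⟨p, hp, -, hpn⟩ := key2 s xs x hs hx
    rwa [huniq (T0 s) p fun a => by rw [hT0, hp]]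
  let T : S →L[ℂ] P := LinearMap.mkContinuous
    { toFun := T0
      map_add' := fun s t => huniq _ _ fun a => by simp [hT0]
      map_smul' := fun c s => huniq _ _ fun a => by simp [hT0] } 1 hT0n
  have hT : ∀ s a, j (η' a) (T s) = ιS s a := hT0
  have hTn : ‖T‖ ≤ 1 := LinearMap.mkContinuous_norm_le _ zero_le_one _
  have hlow : ∀ f : P →L[ℂ] ℂ, ‖f‖ ≤ ‖f.comp T‖ := by
    intro f
    rw [← j.symm.norm_map, ← hΓiso]
    refine ContinuousLinearMap.opNorm_le_bound _ (norm_nonneg _) fun xs => ?_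
    refine ContinuousLinearMap.opNorm_le_bound _ (by positivity) fun x => ?_
    let ys : ℕ → (X →L[ℂ] ℂ) := fun n => if n = 0 then xs else 0
    have hys : ∀ n, n ≠ 0 → ys n = 0 := fun n hn => if_neg hn
    have hys0 : ys 0 = xs := if_pos rfl
    have hs : HasSum (fun n => ‖ys n‖ * ‖x‖) (‖xs‖ * ‖x‖) := by
      have := hasSum_single (f := fun n => ‖ys n‖ * ‖x‖) 0 fun n hn => by simp [hys n hn]
      simpa only [hys0] using this
    have hx : ∀ a, HasSum (fun n => ys n (m x a)) (xs.comp (m x) a) := by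
      intro a
      have := hasSum_single (f := fun n => ys n (m x a)) 0 fun n hn => by simp [hys n hn]
      simpa only [hys0, ContinuousLinearMap.comp_apply] using this
    obtain ⟨s, hsφ⟩ := (hrange (xs.comp (m x))).1 ⟨ys, fun _ => x, hs.summable, hx⟩
    rw [← hsφ] at hx
    obtain ⟨p, hp, hpb, -⟩ := key2 s ys (fun _ => x) hs.summable hx
    have hps : p = T s := huniq _ _ fun a => by rw [hp, hT]
    have h1 := hpb (j.symm f)
    rw [j.apply_symm_apply, tsum_eq_single 0 (fun n hn => by simp [hys n hn]), hys0, hps] at h1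
    have h2 : ‖s‖ ≤ ‖xs‖ * ‖x‖ := by
      rw [hnormS, qNorm]
      refine csInf_le ⟨0, ?_⟩ ⟨ys, fun _ => x, hs.summable, hx, hs.tsum_eq.symm⟩
      rintro c ⟨_, _, -, -, rfl⟩
      exact tsum_nonneg fun n => by positivity
    rw [← h1]
    calc ‖f (T s)‖ ≤ ‖f.comp T‖ * ‖s‖ := (f.comp T).le_opNorm s
      _ ≤ ‖f.comp T‖ * (‖xs‖ * ‖x‖) := by gcongr
      _ = ‖f.comp T‖ * ‖xs‖ * ‖x‖ := by ring
  have hsurj := surj_of_dual_bound T hlow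
  have hTinj : Function.Injective T := by
    intro s t hst
    apply hinj
    ext a
    rw [← hT, ← hT, hst]
  let E : S ≃L[ℂ] P := ContinuousLinearEquiv.ofBijective T
    (LinearMap.ker_eq_bot.2 hTinj) (LinearMap.range_eq_top.2 hsurj)
  have hE : ∀ s, E s = T s := fun s => rfl
  let Φ : B →ₗ[ℂ] (S →L[ℂ] ℂ) :=
    { toFun := fun b => (j b).comp T
      map_add' := fun b c => by ext s; simp
      map_smul' := fun c b => by ext s; simp }
  have hΦ : ∀ b s, Φ b s = j b (T s) := fun _ _ => rfl
  have hΦn : ∀ b, ‖Φ b‖ = ‖b‖ := by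
    intro b
    have h0 : Φ b = (j b).comp T := rfl
    rw [h0]
    apply le_antisymm
    · calc ‖(j b).comp T‖ ≤ ‖j b‖ * ‖T‖ := ContinuousLinearMap.opNorm_comp_le _ _
        _ ≤ ‖j b‖ * 1 := by gcongr
        _ = ‖b‖ := by rw [mul_one, j.norm_map]
    · rw [← j.norm_map b]; exact hlow _
  refine ⟨Φ, ⟨?_, ?_⟩, hΦn, ?_, ?_, ?_⟩
  · refine (injective_iff_map_eq_zero Φ).2 fun b hb => ?_
    rw [← norm_eq_zero, ← hΦn, hb, norm_zero]
  · intro μ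
    refine ⟨j.symm (μ.comp (E.symm : P →L[ℂ] S)), ?_⟩
    ext s
    rw [hΦ, j.apply_symm_apply, ← hE]
    simp
  · refine WeakDual.continuous_of_continuous_eval fun s => ?_
    have h : (fun μ : WeakDual ℂ P => (toW (Φ (j.symm (ofW μ)))) s) = fun μ => μ (T s) := by
      funext μ
      have h1 : (toW (Φ (j.symm (ofW μ)))) s = j (j.symm (ofW μ)) (T s) := rfl
      rw [h1, j.apply_symm_apply]
      rfl
    rw [h]
    exact hev _
  · intro ar har b b'
    ext s
    rw [har, hΦ, hΦ]
    have step1 : ∀ a, j (η' a) (T (box (Φ b') s)) = j (η' a * b') (T s) := by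
      intro a
      obtain ⟨u, hu⟩ := hactS s a
      rw [hT, hbox _ s a u hu, hΦ]
      have h1 := hdet (fun μ => μ (T u)) (fun μ => (toW (j (η' a * j.symm (ofW μ)))) (T s))
        (hev _) ((hev (T s)).comp (hZt a)) (fun c => by
          have e1 : (toW (j (η' c))) (T u) = j (η' c) (T u) := rfl
          have e2 : (toW (j (η' a * j.symm (ofW (toW (j (η' c))))))) (T s)
            = j (η' a * j.symm (j (η' c))) (T s) := rfl
          rw [e1, e2, j.symm_apply_apply, ← hmul, hT, hT, hu]
          rfl) b'
      have e2 : (toW (j (η' a * j.symm (ofW (toW (j b')))))) (T s)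
            = j (η' a * j.symm (j b')) (T s) := rfl
      simp only [e2, j.symm_apply_apply] at h1
      exact h1
    have h1 := hdet (fun μ => μ (T (box (Φ b') s)))
      (fun μ => (toW (j (j.symm (ofW μ) * b'))) (T s))
      (hev _) ((hev (T s)).comp (hw b')) (fun c => by
        have e2 : (toW (j (j.symm (ofW (toW (j (η' c)))) * b'))) (T s)
            = j (j.symm (j (η' c)) * b') (T s) := rfl
        rw [e2, j.symm_apply_apply, ← step1]
        rfl) b
    have e2 : (toW (j (j.symm (ofW (toW (j b))) * b'))) (T s)
            = j (j.symm (j b) * b') (T s) := rfl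
    simp only [e2, j.symm_apply_apply] at h1
    exact h1.symm
  · intro a
    ext s
    rw [hΦ, hT]
    rfl

end
end
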